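/- arXiv:2011.00039 — 9 statements merged into one kernel-verified Lean document; each statement's English description precedes it below -/
import Mathlib

section
/- Let β ∈ ℝ. For every smooth compactly supported function η : ℝ² → ℂ whose support avoids the origin, ∫_{ℝ²} |x|^{−2β} |∂_{z̄}η(x)|² dx ≥ (1/4) · (min_{ℓ∈ℤ} (β−ℓ)²) · ∫_{ℝ²} |x|^{−2β−2} |η(x)|² dx. -/
open MeasureTheory

/-- The Wirtinger derivative `∂_{z̄} η = (1/2)(∂₁ η + i ∂₂ η)`, identifying `ℝ²` with `ℂ`. -/
noncomputable def wirtingerZbar (η : ℂ → ℂ) (x : ℂ) : ℂ :=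
  (1/2 : ℂ) * (fderiv ℝ η x 1 + Complex.I * fderiv ℝ η x Complex.I)

open ComplexConjugate

open Complex ComplexConjugate in
theorem integral_normSq_I_mul_deriv_add_ge {f f' : ℝ → ℂ} (hf : ∀ x, HasDerivAt f (f' x) x)
    (hf' : Continuous f') (hper : f Real.pi = f (-Real.pi)) (β : ℝ) :
    (⨅ ℓ : ℤ, (β - (ℓ : ℝ)) ^ 2) * ∫ x in -Real.pi..Real.pi, ‖f x‖ ^ 2 ≤
      ∫ x in -Real.pi..Real.pi, ‖I * f' x + β * f x‖ ^ 2 := by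
  have hab : -Real.pi < Real.pi := by linarith [Real.pi_pos]
  have hfc : Continuous f := continuous_iff_continuousAt.2 fun x => (hf x).continuousAt
  have hgc : Continuous fun x => I * f' x + β * f x := by fun_prop
  have hL2 : ∀ g : ℝ → ℂ, Continuous g →
      MemLp g 2 (volume.restrict (Set.Ioc (-Real.pi) Real.pi)) := fun g hg =>
    (memLp_two_iff_integrable_sq_norm hg.aestronglyMeasurable).2
      ((hg.norm.pow 2).integrableOn_Icc.mono_set Set.Ioc_subset_Icc_self)
  have hderiv : ∀ n : ℤ, fourierCoeffOn hab f' n = I * n * fourierCoeffOn hab f n := by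
    intro n
    rcases eq_or_ne n 0 with rfl | hn
    · rw [fourierCoeffOn_eq_integral]
      have : ∫ x in -Real.pi..Real.pi, f' x = 0 := by
        rw [intervalIntegral.integral_eq_sub_of_hasDerivAt (fun x _ => hf x)
          (hf'.intervalIntegrable _ _), hper, sub_self]
      simp [this]
    · rw [fourierCoeffOn_of_hasDerivAt hab hn (fun x _ => hf x) (hf'.intervalIntegrable _ _),
        hper, sub_self]
      have hn' : (n : ℂ) ≠ 0 := by exact_mod_cast hn
      have hpi : (Real.pi : ℂ) ≠ 0 := by exact_mod_cast Real.pi_ne_zero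
      field_simp
      push_cast
      ring
  have hcoeff : ∀ n : ℤ, fourierCoeffOn hab (fun x => I * f' x + β * f x) n =
      ((β - n : ℝ) : ℂ) * fourierCoeffOn hab f n := by
    intro n
    have h1 : fourierCoeffOn hab (fun x => I * f' x + β * f x) n =
        I * fourierCoeffOn hab f' n + β * fourierCoeffOn hab f n := by
      have hfour : Continuous fun x : ℝ =>
          (fourier (-n) (x : AddCircle (Real.pi - -Real.pi)) : ℂ) :=
        (map_continuous _).comp (AddCircle.continuous_mk' _)
      simp only [fourierCoeffOn_eq_integral, smul_eq_mul, real_smul]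
      have : ∀ x : ℝ, (fourier (-n) (x : AddCircle (Real.pi - -Real.pi)) : ℂ) *
          (I * f' x + β * f x) =
          I * ((fourier (-n) (x : AddCircle (Real.pi - -Real.pi)) : ℂ) * f' x) +
          β * ((fourier (-n) (x : AddCircle (Real.pi - -Real.pi)) : ℂ) * f x) := fun x => by ring
      simp only [this]
      rw [intervalIntegral.integral_add
        (Continuous.intervalIntegrable (by fun_prop) _ _)
        (Continuous.intervalIntegrable (by fun_prop) _ _),
        intervalIntegral.integral_const_mul, intervalIntegral.integral_const_mul]
      ring
    rw [h1, hderiv]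
    push_cast
    linear_combination (n : ℂ) * fourierCoeffOn hab f n * I_mul_I
  have hF := hasSum_sq_fourierCoeffOn hab (hL2 f hfc)
  have hG := hasSum_sq_fourierCoeffOn hab (hL2 _ hgc)
  have hle := hasSum_le (fun n => ?_) (hF.mul_left (⨅ ℓ : ℤ, (β - (ℓ : ℝ)) ^ 2)) hG
  · rw [smul_eq_mul, smul_eq_mul, mul_left_comm] at hle
    exact le_of_mul_le_mul_left hle (inv_pos.2 (by linarith))
  · rw [hcoeff, norm_mul, mul_pow, norm_real, Real.norm_eq_abs, sq_abs]
    gcongr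
    exact ciInf_le ⟨0, by rintro _ ⟨ℓ, rfl⟩; positivity⟩ n

theorem integral_fderiv_mul_fderiv_comm {f g : ℂ → ℂ} (hf : ContDiff ℝ 2 f) (hg : ContDiff ℝ 2 g)
    (hfs : HasCompactSupport f) (v w : ℂ) :
    ∫ z, fderiv ℝ f z v * fderiv ℝ g z w = ∫ z, fderiv ℝ f z w * fderiv ℝ g z v := by
  have hd : ∀ v, ContDiff ℝ 1 fun z => fderiv ℝ g z v := fun v =>
    (hg.fderiv_right (m := 1) (by norm_num)).clm_apply contDiff_const
  have hdf : ∀ v, Continuous fun z => fderiv ℝ f z v := fun v =>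
    (hf.continuous_fderiv (by norm_num)).clm_apply continuous_const
  have hparts : ∀ v w, ∫ z, fderiv ℝ f z v * fderiv ℝ g z w =
      -∫ z, f z * fderiv ℝ (fun z => fderiv ℝ g z w) z v := by
    intro v w
    have hdd : Continuous fun z => fderiv ℝ (fun z => fderiv ℝ g z w) z v :=
      ((hd w).continuous_fderiv (by norm_num)).clm_apply continuous_const
    rw [integral_mul_fderiv_eq_neg_fderiv_mul_of_integrable (f := f)
      (g := fun z => fderiv ℝ g z w), neg_neg]
    · exact ((hdf v).mul (hd w).continuous).integrable_of_hasCompactSupport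
        ((hfs.fderiv_apply ℝ v).mul_right)
    · exact (hf.continuous.mul hdd).integrable_of_hasCompactSupport hfs.mul_right
    · exact (hf.continuous.mul (hd w).continuous).integrable_of_hasCompactSupport hfs.mul_right
    · exact fun z _ => (hf.differentiable (by norm_num)) z
    · exact fun z _ => ((hd w).differentiable (by norm_num)) z
  have hsymm : ∀ z, fderiv ℝ (fun z => fderiv ℝ g z w) z v =
      fderiv ℝ (fun z => fderiv ℝ g z v) z w := by
    intro z
    have hdz : DifferentiableAt ℝ (fderiv ℝ g) z :=
      ((hg.fderiv_right (m := 1) (by norm_num)).differentiable (by norm_num)) z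
    rw [fderiv_clm_apply hdz (by fun_prop), fderiv_clm_apply hdz (by fun_prop)]
    simpa using (hg.contDiffAt.isSymmSndFDerivAt (by simp)) v w
  rw [hparts v w, hparts w v]
  simp only [hsymm]

theorem integral_inv_mul_zbar_eq_zero {ρ : ℂ → ℂ} (hρ : ContDiff ℝ 1 ρ)
    (hs : HasCompactSupport ρ) (h0 : (0 : ℂ) ∉ tsupport ρ) :
    Integrable (fun z : ℂ => z⁻¹ * (fderiv ℝ ρ z 1 + Complex.I * fderiv ℝ ρ z Complex.I)) ∧
    ∫ z : ℂ, z⁻¹ * (fderiv ℝ ρ z 1 + Complex.I * fderiv ℝ ρ z Complex.I) = 0 := by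
  have hne : ∀ z ∈ tsupport ρ, z ≠ 0 := fun z hz h => h0 (h ▸ hz)
  have hdρ : ∀ v, Continuous fun z => fderiv ℝ ρ z v := fun v =>
    (hρ.continuous_fderiv (by norm_num)).clm_apply continuous_const
  have hinv : ∀ z : ℂ, z ≠ 0 → ∀ v,
      fderiv ℝ (fun z : ℂ => z⁻¹) z v = -(z ^ 2)⁻¹ * v := by
    intro z hz v
    rw [((hasDerivAt_inv hz).hasFDerivAt.restrictScalars ℝ).fderiv]
    simp [mul_comm]
  have hint : ∀ h k : ℂ → ℂ, Continuous k → tsupport k ⊆ tsupport ρ →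
      (∀ z, z ≠ 0 → ContinuousAt h z) → Integrable fun z => h z * k z := by
    intro h k hk hkρ hh
    refine (continuous_of_tsupport fun z hz => ?_).integrable_of_hasCompactSupport
      ((hs.mono' ((subset_tsupport _).trans hkρ)).mul_left)
    exact (hh z (hne z (hkρ (tsupport_mul_subset_right hz)))).mul hk.continuousAt
  have hi : ∀ v, Integrable fun z => z⁻¹ * fderiv ℝ ρ z v := fun v =>
    hint _ _ (hdρ v) (tsupport_fderiv_apply_subset ℝ v) fun z hz => continuousAt_inv₀ hz
  have hi' : ∀ v, Integrable fun z => fderiv ℝ (fun z : ℂ => z⁻¹) z v * ρ z := by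
    intro v
    refine hint _ _ hρ.continuous subset_rfl fun z hz => ?_
    have : (fun z : ℂ => -(z ^ 2)⁻¹ * v) =ᶠ[nhds z]
        fun z => fderiv ℝ (fun z : ℂ => z⁻¹) z v := by
      filter_upwards [isOpen_ne.mem_nhds hz] with w hw using (hinv w hw v).symm
    refine ContinuousAt.congr ?_ this
    have : z ^ 2 ≠ 0 := pow_ne_zero 2 hz
    fun_prop (disch := assumption)
  have hparts : ∀ v, ∫ z, z⁻¹ * fderiv ℝ ρ z v =
      -∫ z, fderiv ℝ (fun z : ℂ => z⁻¹) z v * ρ z := by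
    intro v
    refine integral_mul_fderiv_eq_neg_fderiv_mul_of_integrable (hi' v) (hi v) ?_ ?_ ?_
    · exact hint _ _ hρ.continuous subset_rfl fun z hz => continuousAt_inv₀ hz
    · exact fun z hz => ((hasDerivAt_inv (hne z hz)).hasFDerivAt.restrictScalars
        ℝ).differentiableAt
    · exact fun z _ => (hρ.differentiable (by norm_num)) z
  have hsplit : (fun z : ℂ => z⁻¹ * (fderiv ℝ ρ z 1 + Complex.I * fderiv ℝ ρ z Complex.I)) =
      fun z => z⁻¹ * fderiv ℝ ρ z 1 + Complex.I * (z⁻¹ * fderiv ℝ ρ z Complex.I) := by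
    ext z; ring
  rw [hsplit]
  refine ⟨(hi 1).add ((hi _).const_mul _), ?_⟩
  rw [integral_add (hi 1) ((hi _).const_mul _), integral_const_mul, hparts, hparts, mul_neg,
    ← neg_add, ← integral_const_mul, ← integral_add (hi' 1) ((hi' _).const_mul _), neg_eq_zero]
  refine integral_eq_zero_of_ae (.of_forall fun z => ?_)
  by_cases hz : z = 0
  · simp [hz, image_eq_zero_of_notMem_tsupport h0]
  · simp only [hinv z hz, Pi.zero_apply]
    linear_combination -(z ^ 2)⁻¹ * ρ z * Complex.I_mul_I

open Complex in
theorem lintegral_angular_ge {u : ℂ → ℂ} (hu : ContDiff ℝ 1 u) (β : ℝ) :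
    ∫⁻ z : ℂ, ENNReal.ofReal ((⨅ ℓ : ℤ, (β - (ℓ : ℝ)) ^ 2) * ((‖z‖ ^ 2)⁻¹ * ‖u z‖ ^ 2)) ≤
      ∫⁻ z : ℂ, ENNReal.ofReal ((‖z‖ ^ 2)⁻¹ * ‖I * fderiv ℝ u z (I * z) + β * u z‖ ^ 2) := by
  set m := ⨅ ℓ : ℤ, (β - (ℓ : ℝ)) ^ 2 with hm
  have hm0 : 0 ≤ m := Real.iInf_nonneg fun ℓ => sq_nonneg _
  have hdu : Continuous fun z => fderiv ℝ u z (I * z) :=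
    (hu.continuous_fderiv (by norm_num)).clm_apply (by fun_prop)
  have huc := hu.continuous
  rw [← Complex.lintegral_comp_polarCoord_symm, ← Complex.lintegral_comp_polarCoord_symm]
  have hpm : Continuous fun p : ℝ × ℝ => Complex.polarCoord.symm p := by
    simp only [Complex.polarCoord_symm_apply]
    fun_prop
  rw [polarCoord_target, Measure.volume_eq_prod, ← Measure.prod_restrict,
    lintegral_prod _ ?_, lintegral_prod _ ?_]
  rotate_left
  · refine Measurable.aemeasurable ?_
    have := hdu.comp hpm
    have h2 := huc.comp hpm
    simp only [Function.comp_def] at this h2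
    simp only [smul_eq_mul]
    fun_prop
  · refine Measurable.aemeasurable ?_
    have := hdu.comp hpm
    have h2 := huc.comp hpm
    simp only [Function.comp_def] at this h2
    simp only [smul_eq_mul]
    fun_prop
  refine setLIntegral_mono' measurableSet_Ioi fun r (hr : 0 < r) => ?_
  set e : ℝ → ℂ := fun θ => Complex.polarCoord.symm (r, θ) with he
  have hee : ∀ θ, e θ = r * exp (θ * I) := fun θ => by
    simp [he, Complex.polarCoord_symm_apply, exp_mul_I]
  have hder : ∀ θ, HasDerivAt e (I * e θ) θ := by
    intro θ
    rw [show e = fun θ : ℝ => r * exp (θ * I) from funext hee]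
    have h := (((hasDerivAt_id θ).ofReal_comp.mul_const I).cexp).const_mul (r : ℂ)
    refine h.congr_deriv ?_
    simp
    ring
  have hnorm : ∀ θ, ‖e θ‖ = r := fun θ => by simp [hee, norm_exp, abs_of_pos hr]
  have hec : Continuous e := continuous_iff_continuousAt.2 fun θ => (hder θ).continuousAt
  have hper : e Real.pi = e (-Real.pi) := by simp [he, Complex.polarCoord_symm_apply]
  have hf : ∀ θ, HasDerivAt (fun θ => u (e θ)) (fderiv ℝ u (e θ) (I * e θ)) θ := fun θ =>
    ((hu.differentiable (by norm_num)) (e θ)).hasFDerivAt.comp_hasDerivAt θ (hder θ)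
  have hf' : Continuous fun θ => fderiv ℝ u (e θ) (I * e θ) := hdu.comp hec
  have huec : Continuous fun θ => u (e θ) := huc.comp hec
  have key := integral_normSq_I_mul_deriv_add_ge hf hf' (by rw [hper]) β
  have hlin : ∀ h : ℝ → ℝ, Continuous h → (∀ θ, 0 ≤ h θ) →
      ∫⁻ θ in Set.Ioo (-Real.pi) Real.pi, ENNReal.ofReal (h θ) =
        ENNReal.ofReal (∫ θ in -Real.pi..Real.pi, h θ) := by
    intro h hc h0
    rw [intervalIntegral.integral_of_le (by linarith [Real.pi_pos]),
      ← integral_Ioc_eq_integral_Ioo.symm, ofReal_integral_eq_lintegral_ofReal _ (.of_forall h0)]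
    exact (hc.integrableOn_Icc).mono_set Set.Ioo_subset_Icc_self
  change ∫⁻ θ in Set.Ioo (-Real.pi) Real.pi, ENNReal.ofReal r *
      ENNReal.ofReal (m * ((‖e θ‖ ^ 2)⁻¹ * ‖u (e θ)‖ ^ 2)) ≤
    ∫⁻ θ in Set.Ioo (-Real.pi) Real.pi, ENNReal.ofReal r *
      ENNReal.ofReal ((‖e θ‖ ^ 2)⁻¹ * ‖I * fderiv ℝ u (e θ) (I * e θ) + β * u (e θ)‖ ^ 2)
  simp only [hnorm]
  rw [lintegral_const_mul' _ _ ENNReal.ofReal_ne_top, lintegral_const_mul' _ _ ENNReal.ofReal_ne_top,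
    hlin _ (by fun_prop) (fun θ => by positivity), hlin _ (by fun_prop) (fun θ => by positivity)]
  gcongr
  simp only [intervalIntegral.integral_const_mul]
  rw [mul_left_comm]
  gcongr

theorem norm_sq_zbar_add_ge (β : ℝ) {z : ℂ} (hz : z ≠ 0) (p q w : ℂ) :
    (‖z‖ ^ 2)⁻¹ * ‖Complex.I * (z.re * q - z.im * p) + β * w‖ ^ 2 +
      ((Complex.I * (conj p * q - conj q * p)).re +
        β * (z⁻¹ * ((p * conj w + w * conj p) + Complex.I * (q * conj w + w * conj q))).re) ≤
      ‖p + Complex.I * q + β * w / conj z‖ ^ 2 := by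
  have hn : 0 < z.re * z.re + z.im * z.im := by
    simpa [Complex.normSq_apply] using Complex.normSq_pos.2 hz
  have hz' : conj z ≠ 0 := by simpa using hz
  have hQ : ‖p + Complex.I * q + β * w / conj z‖ ^ 2 =
      (‖z‖ ^ 2)⁻¹ * ‖conj z * (p + Complex.I * q) + β * w‖ ^ 2 := by
    rw [show p + Complex.I * q + β * w / conj z =
      (conj z * (p + Complex.I * q) + β * w) / conj z by field_simp, norm_div, div_pow,
      Complex.norm_conj]
    ring
  have hsq := mul_nonneg (inv_pos.2 hn).le
    (add_nonneg (sq_nonneg (z.re * p.re + z.im * q.re)) (sq_nonneg (z.re * p.im + z.im * q.im)))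
  rw [hQ, ← sub_nonneg]
  refine hsq.trans_eq ?_
  simp only [Complex.sq_norm, Complex.normSq_apply, Complex.inv_def, Complex.add_re, Complex.add_im,
    Complex.mul_re, Complex.mul_im, Complex.sub_re, Complex.sub_im, Complex.I_re, Complex.I_im,
    Complex.conj_re, Complex.conj_im, Complex.ofReal_re, Complex.ofReal_im]
  have hn' : z.re ^ 2 + z.im ^ 2 ≠ 0 := by nlinarith
  field_simp
  ring

theorem contDiffAt_norm_rpow (a : ℝ) {z : ℂ} (hz : z ≠ 0) :
    ContDiffAt ℝ 2 (fun z : ℂ => ((‖z‖ ^ a : ℝ) : ℂ)) z :=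
  Complex.ofRealCLM.contDiff.contDiffAt.comp z
    ((contDiffAt_norm ℝ hz).rpow_const_of_ne (norm_ne_zero_iff.2 hz))

theorem norm_sq_rpow_mul_zbar {η : ℂ → ℂ} {z : ℂ} (hz : z ≠ 0) (β : ℝ)
    (hη : DifferentiableAt ℝ η z) :
    ‖z‖ ^ (-2 * β) * ‖wirtingerZbar η z‖ ^ 2 = (1 / 4) *
      ‖fderiv ℝ (fun z => ((‖z‖ ^ (-β) : ℝ) : ℂ) * η z) z 1 +
        Complex.I * fderiv ℝ (fun z => ((‖z‖ ^ (-β) : ℝ) : ℂ) * η z) z Complex.I +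
        β * (((‖z‖ ^ (-β) : ℝ) : ℂ) * η z) / conj z‖ ^ 2 := by
  have hpos : 0 < ‖z‖ := norm_pos_iff.2 hz
  have hrpow : (fun z : ℂ => ‖z‖ ^ (-β)) = fun z : ℂ => (‖z‖ ^ 2) ^ (-β / 2) := by
    ext z
    rw [← Real.rpow_natCast, ← Real.rpow_mul (norm_nonneg z)]
    congr 1
    push_cast
    ring
  have hs := (hasStrictFDerivAt_norm_sq z).hasFDerivAt.rpow_const (p := -β / 2)
    (Or.inl (by positivity))
  rw [← hrpow] at hs
  have hu := ((Complex.ofRealCLM.hasFDerivAt (x := ‖z‖ ^ (-β))).comp z hs).mul hη.hasFDerivAt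
  have hQ : fderiv ℝ (fun z => ((‖z‖ ^ (-β) : ℝ) : ℂ) * η z) z 1 +
        Complex.I * fderiv ℝ (fun z => ((‖z‖ ^ (-β) : ℝ) : ℂ) * η z) z Complex.I +
        β * (((‖z‖ ^ (-β) : ℝ) : ℂ) * η z) / conj z =
      ((‖z‖ ^ (-β) : ℝ) : ℂ) * (2 * wirtingerZbar η z) := by
    have hpow : (‖z‖ ^ 2) ^ (-β / 2 - 1) = ‖z‖ ^ (-β) * (‖z‖ ^ 2)⁻¹ := by
      rw [Real.rpow_sub (by positivity), Real.rpow_one, congrFun hrpow z, div_eq_mul_inv]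
    have hconj : (conj z)⁻¹ = z * (((‖z‖ ^ 2)⁻¹ : ℝ) : ℂ) := by
      rw [Complex.inv_def, Complex.conj_conj, Complex.normSq_conj, Complex.normSq_eq_norm_sq]
    have hfd : fderiv ℝ (fun z => ((‖z‖ ^ (-β) : ℝ) : ℂ) * η z) z = _ := hu.fderiv
    rw [hfd, div_eq_mul_inv _ (conj z), hconj, wirtingerZbar]
    simp [hpow, Complex.inner]
    linear_combination (-(β : ℂ) * ((‖z‖ ^ (-β) : ℝ) : ℂ) * η z * ((‖z‖ : ℂ) ^ 2)⁻¹) *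
      Complex.re_add_im z
  rw [hQ, norm_mul, norm_mul, mul_pow, mul_pow, Complex.norm_real, Real.norm_eq_abs, sq_abs,
    show -2 * β = -β + -β by ring, Real.rpow_add hpos]
  norm_num
  ring

theorem stmt0 (β : ℝ) (η : ℂ → ℂ) (hsmooth : ContDiff ℝ (⊤ : ℕ∞) η)
    (hsupp : HasCompactSupport η) (h0 : (0 : ℂ) ∉ tsupport η) :
    ∫ x : ℂ, ‖x‖ ^ (-2*β) * ‖wirtingerZbar η x‖^2 ≥
      (1/4) * (⨅ ℓ : ℤ, (β - (ℓ : ℝ))^2) * ∫ x : ℂ, ‖x‖ ^ (-2*β - 2) * ‖η x‖^2 := by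
  have hne : ∀ z ∈ tsupport η, z ≠ 0 := fun z hz h => h0 (h ▸ hz)
  set u : ℂ → ℂ := fun z => ((‖z‖ ^ (-β) : ℝ) : ℂ) * η z with hu_def
  have htu : tsupport u ⊆ tsupport η := tsupport_mul_subset_right
  have hη2 : ContDiff ℝ 2 η := contDiff_infty.1 hsmooth 2
  have hu : ContDiff ℝ 2 u := contDiff_iff_contDiffAt.2 fun z => by
    by_cases hz : z ∈ tsupport u
    · exact (contDiffAt_norm_rpow (-β) (hne z (htu hz))).mul hη2.contDiffAt
    · exact contDiffAt_const.congr_of_eventuallyEq (notMem_tsupport_iff_eventuallyEq.1 hz)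
  have hus : HasCompactSupport u := hsupp.mono' ((subset_tsupport u).trans htu)
  have hdu : Continuous (fderiv ℝ u) := hu.continuous_fderiv (by norm_num)
  have hdu0 : ∀ z ∉ tsupport η, fderiv ℝ u z = 0 := fun z hz =>
    image_eq_zero_of_notMem_tsupport fun h => hz (htu (tsupport_fderiv_subset ℝ h))
  have hu0 : ∀ z ∉ tsupport η, u z = 0 := fun z hz =>
    image_eq_zero_of_notMem_tsupport fun h => hz (htu h)
  have hη0 : ∀ z ∉ tsupport η, η z = 0 := fun z hz => image_eq_zero_of_notMem_tsupport hz
  have hdη0 : ∀ z ∉ tsupport η, fderiv ℝ η z = 0 := fun z hz =>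
    image_eq_zero_of_notMem_tsupport fun h => hz (tsupport_fderiv_subset ℝ h)
  have hint : ∀ (w f : ℂ → ℝ), (∀ z, z ≠ 0 → ContinuousAt w z) → Continuous f →
      (∀ z ∉ tsupport η, f z = 0) → Integrable fun z => w z * f z := by
    intro w f hw hf hf0
    have hsub : tsupport (fun z => w z * f z) ⊆ tsupport η :=
      closure_minimal (fun z hz => by
        by_contra hzη
        exact hz (by simp [hf0 z hzη])) (isClosed_tsupport η)
    exact (continuous_of_tsupport fun z hz =>
      (hw z (hne z (hsub hz))).mul hf.continuousAt).integrable_of_hasCompactSupport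
        (hsupp.mono' ((subset_tsupport _).trans hsub))
  have hrpow : ∀ a : ℝ, ∀ z : ℂ, z ≠ 0 → ContinuousAt (fun z : ℂ => ‖z‖ ^ a) z :=
    fun a z hz => continuous_norm.continuousAt.rpow_const (Or.inl (norm_ne_zero_iff.2 hz))
  have hinv : ∀ z : ℂ, z ≠ 0 → ContinuousAt (fun z : ℂ => (‖z‖ ^ 2)⁻¹) z := fun z hz =>
    (continuous_norm.pow 2).continuousAt.inv₀ (pow_ne_zero 2 (norm_ne_zero_iff.2 hz))
  have hwirt : Continuous (wirtingerZbar η) := by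
    have := hη2.continuous_fderiv (by norm_num)
    unfold wirtingerZbar
    fun_prop
  set E : ℂ → ℝ := fun z =>
    (‖z‖ ^ 2)⁻¹ * ‖Complex.I * fderiv ℝ u z (Complex.I * z) + β * u z‖ ^ 2 with hE_def
  have hE : Integrable E := hint _ _ hinv (by have := hu.continuous; fun_prop) fun z hz => by
    simp [hdu0 z hz, hu0 z hz]
  -- The cross terms in the expansion of the square integrate to zero.
  have hub : ∀ z v, fderiv ℝ (fun z => conj (u z)) z v = conj (fderiv ℝ u z v) := by
    intro z v
    have := (Complex.conjCLE.toContinuousLinearMap.hasFDerivAt (x := u z)).comp z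
      (hu.differentiable (by norm_num) z).hasFDerivAt
    exact congrArg (fun L => L v) this.fderiv
  have hconj : ContDiff ℝ 2 fun z => conj (u z) :=
    Complex.conjCLE.toContinuousLinearMap.contDiff.comp hu
  set N : ℂ → ℂ := fun z => Complex.I * (conj (fderiv ℝ u z 1) * fderiv ℝ u z Complex.I -
    conj (fderiv ℝ u z Complex.I) * fderiv ℝ u z 1) with hN_def
  have hJint : ∀ v w, Integrable fun z => conj (fderiv ℝ u z v) * fderiv ℝ u z w := fun v w =>
    (by fun_prop : Continuous fun z => conj (fderiv ℝ u z v) * fderiv ℝ u z w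
      ).integrable_of_hasCompactSupport ((hus.fderiv_apply ℝ w).mul_left)
  have hN : Integrable N := ((hJint _ _).sub (hJint _ _)).const_mul _
  have hN0 : ∫ z, N z = 0 := by
    have h := integral_fderiv_mul_fderiv_comm hconj hu
      (hus.comp_left (g := fun w => conj w) (map_zero _)) 1 Complex.I
    simp only [hub] at h
    rw [integral_const_mul, integral_sub (hJint _ _) (hJint _ _), h, sub_self, mul_zero]
  have hts : tsupport (fun z => u z * conj (u z)) ⊆ tsupport u := tsupport_mul_subset_left
  obtain ⟨hR, hR0⟩ := integral_inv_mul_zbar_eq_zero (ρ := fun z => u z * conj (u z))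
    ((hu.mul hconj).of_le (by norm_num)) hus.mul_right fun h => h0 (htu (hts h))
  have hρ : ∀ z v, fderiv ℝ (fun z => u z * conj (u z)) z v =
      fderiv ℝ u z v * conj (u z) + u z * conj (fderiv ℝ u z v) := by
    intro z v
    have h1 := hu.differentiable (by norm_num) z
    have h2 := hconj.differentiable (by norm_num) z
    have := (h1.hasFDerivAt.mul h2.hasFDerivAt).fderiv
    have h3 := congrArg (fun L => L v) this
    simp only [add_apply, smul_apply, hub,
      smul_eq_mul] at h3
    refine Eq.trans h3 (by ring)
  simp only [hρ] at hR hR0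
  set R : ℂ → ℂ := fun z => z⁻¹ *
    ((fderiv ℝ u z 1 * conj (u z) + u z * conj (fderiv ℝ u z 1)) + Complex.I *
      (fderiv ℝ u z Complex.I * conj (u z) + u z * conj (fderiv ℝ u z Complex.I))) with hR_def
  have hNre : ∫ z, (N z).re = 0 := by
    have := integral_re hN
    simp only [RCLike.re_to_complex] at this
    rw [this, hN0, Complex.zero_re]
  have hRre : ∫ z, (R z).re = 0 := by
    have := integral_re hR
    simp only [RCLike.re_to_complex] at this
    rw [this, hR0, Complex.zero_re]
  have hcross : Integrable fun z => (N z).re + β * (R z).re := hN.re.add (hR.re.const_mul β)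
  have hcross0 : ∫ z, ((N z).re + β * (R z).re) = 0 := by
    have h := integral_add hN.re (hR.re.const_mul β)
    rw [integral_const_mul] at h
    simp only [RCLike.re_to_complex, hNre, hRre, mul_zero, add_zero] at h
    exact h
  have hrot : ∀ z, fderiv ℝ u z (Complex.I * z) =
      z.re * fderiv ℝ u z Complex.I - z.im * fderiv ℝ u z 1 := by
    intro z
    have : Complex.I * z = z.re • Complex.I - z.im • (1 : ℂ) := by
      apply Complex.ext <;> simp
    rw [this, map_sub, map_smul, map_smul, Complex.real_smul, Complex.real_smul]
  have hpoint : ∀ z, (1 / 4) * (E z + ((N z).re + β * (R z).re)) ≤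
      ‖z‖ ^ (-2 * β) * ‖wirtingerZbar η z‖ ^ 2 := by
    intro z
    by_cases hz : z ∈ tsupport η
    · have hz0 := hne z hz
      rw [norm_sq_rpow_mul_zbar hz0 β (hη2.differentiable (by norm_num) z)]
      have h := norm_sq_zbar_add_ge β hz0 (fderiv ℝ u z 1) (fderiv ℝ u z Complex.I) (u z)
      rw [← hrot] at h
      exact mul_le_mul_of_nonneg_left h (by norm_num)
    · simp [hE_def, hN_def, hR_def, wirtingerZbar, hdu0 z hz, hu0 z hz, hdη0 z hz]
  have hbound : (1 / 4) * ∫ z, E z ≤ ∫ z, ‖z‖ ^ (-2 * β) * ‖wirtingerZbar η z‖ ^ 2 := by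
    have h := integral_mono ((hE.add hcross).const_mul (1 / 4))
      (hint _ _ (hrpow (-2 * β)) (hwirt.norm.pow 2) fun z hz => by
        simp [wirtingerZbar, hdη0 z hz]) hpoint
    rw [integral_const_mul] at h
    simp only [Pi.add_apply] at h
    rwa [integral_add hE hcross, hcross0, add_zero] at h
  have hweight : ∀ z : ℂ, ‖z‖ ^ (-2 * β - 2) * ‖η z‖ ^ 2 = (‖z‖ ^ 2)⁻¹ * ‖u z‖ ^ 2 := by
    intro z
    by_cases hz : z ∈ tsupport η
    · have hpos : 0 < ‖z‖ := norm_pos_iff.2 (hne z hz)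
      rw [hu_def, norm_mul, mul_pow, Complex.norm_real, Real.norm_eq_abs, sq_abs,
        show -2 * β - 2 = -β + -β - (2 : ℕ) by push_cast; ring, Real.rpow_sub hpos,
        Real.rpow_add hpos, Real.rpow_natCast]
      ring
    · simp [hη0 z hz, hu0 z hz]
  have hangular : (⨅ ℓ : ℤ, (β - (ℓ : ℝ)) ^ 2) * ∫ z : ℂ, (‖z‖ ^ 2)⁻¹ * ‖u z‖ ^ 2 ≤
      ∫ z, E z := by
    have hm0 : 0 ≤ ⨅ ℓ : ℤ, (β - (ℓ : ℝ)) ^ 2 := Real.iInf_nonneg fun ℓ => sq_nonneg _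
    have hE0 : ∀ z, 0 ≤ E z := fun z => mul_nonneg (by positivity) (by positivity)
    have hi := (hint _ (fun z => ‖u z‖ ^ 2) hinv (hu.continuous.norm.pow 2) fun z hz => by
      simp [hu0 z hz]).const_mul (⨅ ℓ : ℤ, (β - (ℓ : ℝ)) ^ 2)
    rw [← integral_const_mul, ← ENNReal.ofReal_le_ofReal_iff
      (integral_nonneg hE0),
      ofReal_integral_eq_lintegral_ofReal hi (.of_forall fun z => by positivity),
      ofReal_integral_eq_lintegral_ofReal hE (.of_forall hE0)]
    exact lintegral_angular_ge (hu.of_le (by norm_num)) β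
  simp only [hweight]
  rw [ge_iff_le, mul_assoc]
  exact (mul_le_mul_of_nonneg_left hangular (by norm_num)).trans hbound
end

section
/- Let β ∈ ℝ. For every smooth compactly supported function η : ℝ² → ℂ whose support avoids the origin, ∫_{ℝ²} |x|^{2β} |∂_z η(x)|² dx ≥ (1/4) · (min_{ℓ∈ℤ} (β−ℓ)²) · ∫_{ℝ²} |x|^{2β−2} |η(x)|² dx. -/
open MeasureTheory

/-- The Wirtinger derivative `∂_z η = (1/2)(∂₁ η - i ∂₂ η)`, identifying `ℝ²` with `ℂ`. -/
noncomputable def wirtingerZ (η : ℂ → ℂ) (x : ℂ) : ℂ :=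
  (1/2 : ℂ) * (fderiv ℝ η x 1 - Complex.I * fderiv ℝ η x Complex.I)

theorem polar_exp_integral {G : ℂ → ℝ} {a b : ℝ} (hab : a ≤ b) (hG : ContinuousOn G {0}ᶜ)
    (hsupp : ∀ z, G z ≠ 0 → Real.exp a < ‖z‖ ∧ ‖z‖ ≤ Real.exp b) :
    ∫ z, G z = ∫ t in a..b, ∫ θ in (-Real.pi)..Real.pi,
      Real.exp t ^ 2 * G (Complex.exp (t + θ * Complex.I)) := by
  have hexp : Real.exp a ≤ Real.exp b := Real.exp_le_exp.mpr hab
  have hpi : -Real.pi ≤ Real.pi := by linarith [Real.pi_pos]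
  have hsub : Set.Ioc (Real.exp a) (Real.exp b) ×ˢ Set.Ioo (-Real.pi) Real.pi ⊆
      Complex.polarCoord.target := by
    rw [Complex.polarCoord_target]
    exact Set.prod_mono (fun r hr => (Real.exp_pos a).trans hr.1) subset_rfl
  have hint : IntegrableOn (fun p : ℝ × ℝ => p.1 * G (Complex.polarCoord.symm p))
      (Set.Ioc (Real.exp a) (Real.exp b) ×ˢ Set.Ioo (-Real.pi) Real.pi) (volume.prod volume) := by
    have hK : IsCompact (Set.Icc (Real.exp a) (Real.exp b) ×ˢ Set.Icc (-Real.pi) Real.pi) :=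
      isCompact_Icc.prod isCompact_Icc
    refine IntegrableOn.mono_set (ContinuousOn.integrableOn_compact hK ?_)
      (Set.prod_mono Set.Ioc_subset_Icc_self Set.Ioo_subset_Icc_self)
    refine continuousOn_fst.mul (hG.comp ?_ ?_)
    · exact ContinuousOn.congr (f := fun p : ℝ × ℝ =>
        (p.1 : ℂ) * (Real.cos p.2 + Real.sin p.2 * Complex.I)) (by fun_prop)
        fun p _ => Complex.polarCoord_symm_apply p
    · rintro p ⟨hp, -⟩
      have : 0 < p.1 := (Real.exp_pos a).trans_le hp.1
      rw [Set.mem_compl_singleton_iff, ← norm_pos_iff, Complex.norm_polarCoord_symm]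
      exact abs_pos.mpr this.ne'
  calc ∫ z, G z
      = ∫ p in Complex.polarCoord.target, p.1 * G (Complex.polarCoord.symm p) :=
        (Complex.integral_comp_polarCoord_symm G).symm
    _ = ∫ p in Set.Ioc (Real.exp a) (Real.exp b) ×ˢ Set.Ioo (-Real.pi) Real.pi,
          p.1 * G (Complex.polarCoord.symm p) := by
        refine setIntegral_eq_of_subset_of_forall_sdiff_eq_zero
          (measurableSet_Ioi.prod measurableSet_Ioo) hsub ?_
        rintro p ⟨⟨hp, hp'⟩, hp2⟩
        by_contra hne
        have := hsupp _ (right_ne_zero_of_mul hne)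
        rw [Complex.norm_polarCoord_symm, abs_of_pos hp] at this
        exact hp2 ⟨this, hp'⟩
    _ = ∫ r in Real.exp a..Real.exp b, ∫ θ in (-Real.pi)..Real.pi,
          r * G (Complex.polarCoord.symm (r, θ)) := by
        rw [Measure.volume_eq_prod, setIntegral_prod _ hint,
          intervalIntegral.integral_of_le hexp]
        simp_rw [intervalIntegral.integral_of_le hpi, integral_Ioc_eq_integral_Ioo]
    _ = _ := by
        rw [← intervalIntegral.integral_comp_mul_deriv_of_deriv_nonneg
          Real.continuous_exp.continuousOn (fun x _ => Real.hasDerivAt_exp x)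
          (fun x _ => (Real.exp_pos x).le)]
        refine intervalIntegral.integral_congr fun t _ => ?_
        simp only [Function.comp_apply]
        rw [← intervalIntegral.integral_mul_const]
        refine intervalIntegral.integral_congr fun θ _ => ?_
        simp only [Complex.polarCoord_symm_apply, Complex.exp_add, Complex.exp_mul_I,
          Complex.ofReal_exp, Complex.ofReal_cos, Complex.ofReal_sin]
        ring

theorem fourier_poincare (β : ℝ) {g g' : ℝ → ℂ} (hg : ∀ x, HasDerivAt g (g' x) x)
    (hg' : Continuous g') (hper : g Real.pi = g (-Real.pi)) :
    (⨅ ℓ : ℤ, (β - (ℓ : ℝ)) ^ 2) * ∫ θ in (-Real.pi)..Real.pi, ‖g θ‖ ^ 2 ≤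
      ∫ θ in (-Real.pi)..Real.pi, ‖-Complex.I * g' θ - β * g θ‖ ^ 2 := by
  have hpi : -Real.pi < Real.pi := by linarith [Real.pi_pos]
  have hgc : Continuous g := continuous_iff_continuousAt.mpr fun x => (hg x).continuousAt
  have hL2 {f : ℝ → ℂ} (hf : Continuous f) :
      MemLp f 2 (volume.restrict (Set.Ioc (-Real.pi) Real.pi)) := by
    obtain ⟨C, hC⟩ := isCompact_Icc.exists_bound_of_continuousOn
      (hf.continuousOn (s := Set.Icc (-Real.pi) Real.pi))
    exact MemLp.of_bound hf.aestronglyMeasurable C <|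
      (ae_restrict_iff' measurableSet_Ioc).mpr <| ae_of_all _ fun x hx =>
        hC x (Set.Ioc_subset_Icc_self hx)
  have hcoef (n : ℤ) : fourierCoeffOn hpi (fun θ => -Complex.I * g' θ - β * g θ) n =
      ((n : ℂ) - β) * fourierCoeffOn hpi g n := by
    have hd : fourierCoeffOn hpi g' n = Complex.I * n * fourierCoeffOn hpi g n := by
      rcases eq_or_ne n 0 with rfl | hn
      · rw [fourierCoeffOn_eq_integral]
        simp [intervalIntegral.integral_eq_sub_of_hasDerivAt (fun x _ => hg x)
          (hg'.intervalIntegrable _ _), hper]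
      · rw [fourierCoeffOn_of_hasDerivAt hpi hn (fun x _ => hg x) (hg'.intervalIntegrable _ _),
          hper]
        have : (Real.pi : ℂ) ≠ 0 := by exact_mod_cast Real.pi_ne_zero
        have : (n : ℂ) ≠ 0 := by exact_mod_cast hn
        push_cast
        field_simp
        ring
    have hs : fourierCoeffOn hpi (fun θ => -Complex.I * g' θ - β * g θ) n =
        -Complex.I * fourierCoeffOn hpi g' n - β * fourierCoeffOn hpi g n := by
      rw [← fourierCoeffOn.const_mul, ← fourierCoeffOn.const_mul]
      simp only [fourierCoeffOn_eq_integral]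
      rw [← smul_sub, ← intervalIntegral.integral_sub]
      · simp only [smul_sub]
      all_goals
        apply Continuous.intervalIntegrable
        exact ((map_continuous (fourier (-n))).comp (AddCircle.continuous_mk' _)).smul
          (by fun_prop)
    rw [hs, hd]
    linear_combination (-(n : ℂ) * fourierCoeffOn hpi g n) * Complex.I_mul_I
  have h1 := hasSum_sq_fourierCoeffOn hpi (hL2 hgc)
  have h2 := hasSum_sq_fourierCoeffOn hpi
    (hL2 (f := fun θ => -Complex.I * g' θ - β * g θ) (by fun_prop))
  have h3 := hasSum_le (fun n => ?_) (h1.mul_left (⨅ ℓ : ℤ, (β - (ℓ : ℝ)) ^ 2)) h2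
  · simp only [smul_eq_mul] at h3
    rw [mul_left_comm] at h3
    exact le_of_mul_le_mul_left h3 (inv_pos.mpr (by linarith))
  · rw [hcoef, norm_mul, mul_pow]
    refine mul_le_mul_of_nonneg_right ?_ (by positivity)
    have : ‖(n : ℂ) - β‖ ^ 2 = (β - n) ^ 2 := by
      rw [← Complex.ofReal_intCast, ← Complex.ofReal_sub, Complex.norm_real, Real.norm_eq_abs,
        sq_abs]
      ring
    rw [this]
    exact ciInf_le ⟨0, by rintro _ ⟨m, rfl⟩; positivity⟩ n

theorem strip_inequality (β : ℝ) {u : ℝ × ℝ → ℂ} (hu : ContDiff ℝ 2 u) {a b : ℝ} (hab : a ≤ b)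
    (hper : ∀ p, u (p + (0, 2 * Real.pi)) = u p)
    (ha : ∀ θ, u (a, θ) = 0) (hb : ∀ θ, u (b, θ) = 0) :
    (⨅ ℓ : ℤ, (β - (ℓ : ℝ)) ^ 2) *
        ∫ t in a..b, ∫ θ in (-Real.pi)..Real.pi, ‖u (t, θ)‖ ^ 2 ≤
      ∫ t in a..b, ∫ θ in (-Real.pi)..Real.pi,
        ‖fderiv ℝ u (t, θ) (1, 0) - Complex.I * fderiv ℝ u (t, θ) (0, 1) - β * u (t, θ)‖ ^ 2 := by
  have hpi : -Real.pi ≤ Real.pi := by linarith [Real.pi_pos]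
  set P : ℝ × ℝ → ℂ := fun p => fderiv ℝ u p (1, 0) with hP
  set Q : ℝ × ℝ → ℂ := fun p => fderiv ℝ u p (0, 1) with hQ
  have hdu : ContDiff ℝ 1 (fderiv ℝ u) := hu.fderiv_right (by norm_num)
  have hPc : ContDiff ℝ 1 P := hdu.clm_apply contDiff_const
  have hQc : ContDiff ℝ 1 Q := hdu.clm_apply contDiff_const
  have hu1 : ContDiff ℝ 1 u := hu.of_le (by norm_num)
  have hud (p) : HasFDerivAt u (fderiv ℝ u p) p :=
    (hu1.differentiable (by norm_num) p).hasFDerivAt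
  have hPd (p) : HasFDerivAt P (fderiv ℝ P p) p :=
    (hPc.differentiable (by norm_num) p).hasFDerivAt
  have hQd (p) : HasFDerivAt Q (fderiv ℝ Q p) p :=
    (hQc.differentiable (by norm_num) p).hasFDerivAt
  have hsymm (p) : fderiv ℝ P p (0, 1) = fderiv ℝ Q p (1, 0) := by
    have h := (hu.contDiffAt (x := p)).isSymmSndFDerivAt (by simp) (0, 1) (1, 0)
    have hdd := (hdu.differentiable (by norm_num) p).hasFDerivAt
    rw [(hdd.clm_apply (hasFDerivAt_const ((1 : ℝ), (0 : ℝ)) p)).fderiv,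
      (hdd.clm_apply (hasFDerivAt_const ((0 : ℝ), (1 : ℝ)) p)).fderiv]
    simpa using h
  set f : ℝ × ℝ → ℂ := fun p => u p * star (-Complex.I * Q p - β * u p) with hf
  set g : ℝ × ℝ → ℂ := fun p => -Complex.I * (u p * star (P p)) with hg
  set A : ℝ × ℝ → ℂ := fun p => -Complex.I * Q p - β * u p with hA
  set D : ℝ × ℝ → ℝ := fun p => 2 * (P p * star (A p)).re with hD
  have hfd (p) : HasFDerivAt f _ p :=
    (hud p).mul' (((hQd p).const_mul (-Complex.I)).sub ((hud p).const_mul (β : ℂ))).star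
  have hgd (p) : HasFDerivAt g _ p := ((hud p).mul' (hPd p).star).const_mul (-Complex.I)
  have hdiv (p) : fderiv ℝ f p (1, 0) + fderiv ℝ g p (0, 1) = (D p : ℂ) := by
    rw [(hfd p).fderiv, (hgd p).fderiv]
    have e1 : fderiv ℝ u p (1, 0) = P p := rfl
    have e2 : fderiv ℝ u p (0, 1) = Q p := rfl
    rw [show (D p : ℂ) = _ from (Complex.add_conj (P p * star (A p))).symm]
    simp [hsymm, e1, e2, hA]
    ring
  have hDc : Continuous D := by
    have := hPc.continuous
    have := hQc.continuous
    have := hu.continuous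
    fun_prop
  have hPper (p) : P (p + (0, 2 * Real.pi)) = P p := by
    simp only [hP]
    rw [← fderiv_comp_add_right]
    simp_rw [hper]
  have hzero : ∫ t in a..b, ∫ θ in (-Real.pi)..Real.pi, D (t, θ) = 0 := by
    have h := integral2_divergence_prod_of_hasFDerivAt f g (fderiv ℝ f) (fderiv ℝ g)
      a (-Real.pi) b Real.pi
      (fun p _ => (hfd p).continuousAt.continuousWithinAt)
      (fun p _ => (hgd p).continuousAt.continuousWithinAt)
      (fun p _ => (hfd p).differentiableAt.hasFDerivAt)
      (fun p _ => (hgd p).differentiableAt.hasFDerivAt)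
      (by
        simp_rw [hdiv]
        exact (Complex.continuous_ofReal.comp hDc).continuousOn.integrableOn_compact
          (isCompact_uIcc.prod isCompact_uIcc))
    have hgper (t : ℝ) : g (t, Real.pi) = g (t, -Real.pi) := by
      have : ((t, Real.pi) : ℝ × ℝ) = (t, -Real.pi) + (0, 2 * Real.pi) := by
        ext <;> simp; ring
      simp only [hg]
      rw [this, hper, hPper]
    have hfa (θ : ℝ) : f (a, θ) = 0 := by simp [hf, ha]
    have hfb (θ : ℝ) : f (b, θ) = 0 := by simp [hf, hb]
    simp only [hdiv, hgper, hfa, hfb, intervalIntegral.integral_ofReal] at h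
    simpa [← Complex.ofReal_zero] using h
  have hcont {F : ℝ × ℝ → ℝ} (hF : Continuous F) :
      Continuous fun t => ∫ θ in (-Real.pi)..Real.pi, F (t, θ) :=
    intervalIntegral.continuous_parametric_intervalIntegral_of_continuous'
      (f := fun t θ => F (t, θ)) hF _ _
  have hslice (t : ℝ) {F : ℝ × ℝ → ℝ} (hF : Continuous F) :
      IntervalIntegrable (fun θ => F (t, θ)) volume (-Real.pi) Real.pi :=
    (hF.comp (by fun_prop : Continuous fun θ : ℝ => (t, θ))).intervalIntegrable _ _
  have hPc' := hPc.continuous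
  have hQc' := hQc.continuous
  have huc' := hu.continuous
  have hAc : Continuous A := by fun_prop
  have hu2 : Continuous fun p => ‖u p‖ ^ 2 := by fun_prop
  have hA2 : Continuous fun p => ‖A p‖ ^ 2 := by fun_prop
  have hT2 : Continuous fun p => ‖P p - Complex.I * Q p - β * u p‖ ^ 2 := by fun_prop
  have hrow (t : ℝ) : (⨅ ℓ : ℤ, (β - (ℓ : ℝ)) ^ 2) *
      (∫ θ in (-Real.pi)..Real.pi, ‖u (t, θ)‖ ^ 2) + ∫ θ in (-Real.pi)..Real.pi, D (t, θ) ≤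
      ∫ θ in (-Real.pi)..Real.pi, ‖P (t, θ) - Complex.I * Q (t, θ) - β * u (t, θ)‖ ^ 2 := by
    have h1 : (⨅ ℓ : ℤ, (β - (ℓ : ℝ)) ^ 2) * (∫ θ in (-Real.pi)..Real.pi, ‖u (t, θ)‖ ^ 2) ≤
        ∫ θ in (-Real.pi)..Real.pi, ‖A (t, θ)‖ ^ 2 := by
      refine fourier_poincare β (g := fun θ => u (t, θ)) (g' := fun θ => Q (t, θ))
        (fun θ => ?_) (by fun_prop) ?_
      · exact (hud (t, θ)).comp_hasDerivAt θ ((hasDerivAt_const θ t).prodMk (hasDerivAt_id θ))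
      · rw [← hper (t, -Real.pi)]
        congr 1
        ext <;> simp
        ring
    refine (add_le_add_left h1 _).trans ?_
    rw [← intervalIntegral.integral_add (hslice t hA2) (hslice t hDc)]
    refine intervalIntegral.integral_mono_on hpi
      ((hslice t hA2).add (hslice t hDc)) (hslice t hT2) fun θ _ => ?_
    have : P (t, θ) - Complex.I * Q (t, θ) - β * u (t, θ) = P (t, θ) + A (t, θ) := by
      simp only [hA]; ring
    rw [this]
    simp only [hD, ← Complex.normSq_eq_norm_sq, Complex.normSq_add]
    have := Complex.normSq_nonneg (P (t, θ))
    simp only [Complex.star_def]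
    linarith
  calc _ = ∫ t in a..b, ((⨅ ℓ : ℤ, (β - (ℓ : ℝ)) ^ 2) *
        (∫ θ in (-Real.pi)..Real.pi, ‖u (t, θ)‖ ^ 2) + ∫ θ in (-Real.pi)..Real.pi, D (t, θ)) := by
        rw [intervalIntegral.integral_add
          (((hcont hu2).const_mul _).intervalIntegrable _ _)
          ((hcont hDc).intervalIntegrable _ _), hzero, intervalIntegral.integral_const_mul,
          add_zero]
    _ ≤ _ := intervalIntegral.integral_mono_on hab
        ((((hcont hu2).const_mul _).add (hcont hDc)).intervalIntegrable _ _)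
        ((hcont hT2).intervalIntegrable _ _) fun t _ => hrow t

theorem two_mul_mul_wirtingerZ (η : ℂ → ℂ) (x z : ℂ) :
    2 * (z * wirtingerZ η x) = fderiv ℝ η x z - Complex.I * fderiv ℝ η x (z * Complex.I) := by
  have h (a b : ℝ) : fderiv ℝ η x (a + b * Complex.I) =
      a * fderiv ℝ η x 1 + b * fderiv ℝ η x Complex.I := by
    rw [show (a + b * Complex.I : ℂ) = a • (1 : ℂ) + b • Complex.I by simp, map_add, map_smul,
      map_smul, Complex.real_smul, Complex.real_smul]
  have h1 := h z.re z.im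
  have h2 := h (-z.im) z.re
  rw [Complex.re_add_im] at h1
  rw [show ((-z.im : ℝ) + z.re * Complex.I : ℂ) = z * Complex.I by
    simp [Complex.ext_iff]] at h2
  rw [h1, h2, wirtingerZ]
  nth_rw 1 [← Complex.re_add_im z]
  push_cast
  linear_combination (-(z.im : ℂ) * fderiv ℝ η x Complex.I) * Complex.I_sq

theorem exists_exp_annulus {η : ℂ → ℂ} (hsupp : HasCompactSupport η)
    (h0 : (0 : ℂ) ∉ tsupport η) :
    ∃ a b : ℝ, a ≤ b ∧ ∀ z ∈ tsupport η, Real.exp a < ‖z‖ ∧ ‖z‖ < Real.exp b := by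
  obtain ⟨C, hC⟩ := hsupp.isCompact.exists_bound_of_continuousOn (f := id) continuousOn_id
  obtain ⟨ε, hε, hball⟩ := Metric.isOpen_iff.mp (isClosed_tsupport η).isOpen_compl 0 h0
  have hM : 0 < max (ε / 2) (C + 1) := lt_max_of_lt_left (by linarith)
  refine ⟨Real.log (ε / 2), Real.log (max (ε / 2) (C + 1)),
    Real.log_le_log (by linarith) (le_max_left _ _), fun z hz => ?_⟩
  rw [Real.exp_log (by linarith), Real.exp_log hM]
  constructor
  · by_contra! h
    exact hball (show z ∈ Metric.ball 0 ε by rw [mem_ball_zero_iff]; linarith) hz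
  · have := hC z hz
    simp only [id] at this
    exact lt_max_of_lt_right (by linarith)

theorem stmt1 (β : ℝ) (η : ℂ → ℂ) (hsmooth : ContDiff ℝ (⊤ : ℕ∞) η)
    (hsupp : HasCompactSupport η) (h0 : (0 : ℂ) ∉ tsupport η) :
    ∫ x : ℂ, ‖x‖ ^ (2*β) * ‖wirtingerZ η x‖^2 ≥
      (1/4) * (⨅ ℓ : ℤ, (β - (ℓ : ℝ))^2) * ∫ x : ℂ, ‖x‖ ^ (2*β - 2) * ‖η x‖^2 := by
  obtain ⟨a, b, hab, hann⟩ := exists_exp_annulus hsupp h0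
  have hη (z : ℂ) (hz : η z ≠ 0) : z ∈ tsupport η := subset_tsupport η hz
  have hW (z : ℂ) (hz : wirtingerZ η z ≠ 0) : z ∈ tsupport η := by
    by_contra h
    exact hz (by simp [wirtingerZ, fderiv_of_notMem_tsupport ℝ h])
  have hdc : Continuous (fderiv ℝ η) := hsmooth.continuous_fderiv (by simp)
  have hWc : Continuous (wirtingerZ η) := by
    unfold wirtingerZ
    fun_prop
  have hηc := hsmooth.continuous
  have hpow (s : ℝ) : ContinuousOn (fun z : ℂ => ‖z‖ ^ s) {0}ᶜ :=
    continuous_norm.continuousOn.rpow_const fun z hz => Or.inl (norm_ne_zero_iff.mpr hz)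
  have hpolar (s : ℝ) {φ : ℂ → ℂ} (hφ : Continuous φ) (hφs : ∀ z, φ z ≠ 0 → z ∈ tsupport η) :
      ∫ z, ‖z‖ ^ s * ‖φ z‖ ^ 2 = ∫ t in a..b, ∫ θ in (-Real.pi)..Real.pi,
        Real.exp t ^ 2 * (‖Complex.exp (t + θ * Complex.I)‖ ^ s *
          ‖φ (Complex.exp (t + θ * Complex.I))‖ ^ 2) :=
    polar_exp_integral hab ((hpow s).mul (by fun_prop)) fun z hz =>
      (hann z (hφs z fun h => hz (by simp [h]))).imp_right le_of_lt
  rw [hpolar _ hWc hW, hpolar _ hηc hη]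
  set w : ℝ × ℝ → ℂ := fun p => Complex.exp (p.1 + p.2 * Complex.I) with hw
  set u : ℝ × ℝ → ℂ := fun p => Real.exp (β * p.1) * η (w p) with hu
  have hwc : ContDiff ℝ 2 w := by
    have h1 : ContDiff ℝ 2 fun p : ℝ × ℝ => (p.1 : ℂ) :=
      Complex.ofRealCLM.contDiff.comp contDiff_fst
    have h2 : ContDiff ℝ 2 fun p : ℝ × ℝ => (p.2 : ℂ) :=
      Complex.ofRealCLM.contDiff.comp contDiff_snd
    exact (h1.add (h2.mul contDiff_const)).cexp
  have huc : ContDiff ℝ 2 u := by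
    have h1 : ContDiff ℝ 2 fun p : ℝ × ℝ => (Real.exp (β * p.1) : ℂ) :=
      Complex.ofRealCLM.contDiff.comp (contDiff_const.mul contDiff_fst).exp
    exact h1.mul ((contDiff_infty.mp hsmooth 2).comp hwc)
  have hwnorm (t θ : ℝ) : ‖w (t, θ)‖ = Real.exp t := by simp [hw, Complex.norm_exp]
  have hvan (p) (hp : w p ∉ tsupport η) : u p = 0 := by
    simp [hu, image_eq_zero_of_notMem_tsupport hp]
  have hwper (p) : w (p + (0, 2 * Real.pi)) = w p := by
    simp only [hw, Prod.fst_add, Prod.snd_add, add_zero]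
    rw [← Complex.exp_periodic (p.1 + p.2 * Complex.I)]
    congr 1
    push_cast
    ring
  have hηd (z) : HasFDerivAt η (fderiv ℝ η z) z :=
    (hsmooth.differentiable (by simp) z).hasFDerivAt
  have hud (p) : HasFDerivAt u (fderiv ℝ u p) p :=
    (huc.differentiable (by norm_num) p).hasFDerivAt
  have hut (t θ : ℝ) : fderiv ℝ u (t, θ) (1, 0) =
      Real.exp (β * t) * (β * η (w (t, θ)) + fderiv ℝ η (w (t, θ)) (w (t, θ))) := by
    have h1 := (hud (t, θ)).comp_hasDerivAt t ((hasDerivAt_id t).prodMk (hasDerivAt_const t θ))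
    have h2 : HasDerivAt (fun s : ℝ => w (s, θ)) (w (t, θ)) t := by
      simpa [hw] using (((hasDerivAt_id t).ofReal_comp).add_const (θ * Complex.I)).cexp
    have h3 := ((hasDerivAt_id t).const_mul β).exp.ofReal_comp.mul ((hηd _).comp_hasDerivAt t h2)
    refine (h1.unique h3).trans ?_
    simp
    ring
  have huθ (t θ : ℝ) : fderiv ℝ u (t, θ) (0, 1) =
      Real.exp (β * t) * fderiv ℝ η (w (t, θ)) (w (t, θ) * Complex.I) := by
    have h1 := (hud (t, θ)).comp_hasDerivAt θ ((hasDerivAt_const θ t).prodMk (hasDerivAt_id θ))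
    have h2 : HasDerivAt (fun s : ℝ => w (t, s)) (w (t, θ) * Complex.I) θ := by
      simpa [hw] using
        (((hasDerivAt_id θ).ofReal_comp.mul_const Complex.I).const_add (t : ℂ)).cexp
    have h3 := ((hηd _).comp_hasDerivAt θ h2).const_mul (Real.exp (β * t) : ℂ)
    exact h1.unique h3
  have hkey (t θ : ℝ) : fderiv ℝ u (t, θ) (1, 0) - Complex.I * fderiv ℝ u (t, θ) (0, 1) -
      β * u (t, θ) = 2 * Real.exp (β * t) * w (t, θ) * wirtingerZ η (w (t, θ)) := by
    rw [hut, huθ, hu]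
    linear_combination -(Real.exp (β * t) : ℂ) * two_mul_mul_wirtingerZ η (w (t, θ)) (w (t, θ))
  have hexp (s t : ℝ) : Real.exp t ^ s = Real.exp (t * s) := (Real.exp_mul t s).symm
  have hL (t θ : ℝ) : Real.exp t ^ 2 * (‖w (t, θ)‖ ^ (2 * β) * ‖wirtingerZ η (w (t, θ))‖ ^ 2) =
      1 / 4 * ‖fderiv ℝ u (t, θ) (1, 0) - Complex.I * fderiv ℝ u (t, θ) (0, 1) -
        β * u (t, θ)‖ ^ 2 := by
    rw [hkey]
    simp only [norm_mul, hwnorm, hexp, Complex.norm_real, Real.norm_eq_abs, Real.abs_exp,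
      Complex.norm_ofNat]
    rw [show t * (2 * β) = β * t + β * t by ring, Real.exp_add]
    ring
  have hR (t θ : ℝ) : Real.exp t ^ 2 * (‖w (t, θ)‖ ^ (2 * β - 2) * ‖η (w (t, θ))‖ ^ 2) =
      ‖u (t, θ)‖ ^ 2 := by
    simp only [hu, norm_mul, hwnorm, hexp, Complex.norm_real, Real.norm_eq_abs, Real.abs_exp]
    rw [mul_pow, ← mul_assoc, sq, sq (Real.exp (β * t)), ← Real.exp_add, ← Real.exp_add,
      ← Real.exp_add]
    ring_nf
  have hmain := strip_inequality β huc hab (fun p => by simp [hu, hwper])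
    (fun θ => hvan _ fun h => (hann _ h).1.ne (hwnorm a θ).symm)
    (fun θ => hvan _ fun h => (hann _ h).2.ne (hwnorm b θ))
  calc _ = 1 / 4 * ∫ t in a..b, ∫ θ in (-Real.pi)..Real.pi,
          ‖fderiv ℝ u (t, θ) (1, 0) - Complex.I * fderiv ℝ u (t, θ) (0, 1) -
            β * u (t, θ)‖ ^ 2 := by
        simp only [← intervalIntegral.integral_const_mul]
        exact intervalIntegral.integral_congr fun t _ =>
          intervalIntegral.integral_congr fun θ _ => hL t θ
    _ ≥ 1 / 4 * ((⨅ ℓ : ℤ, (β - (ℓ : ℝ)) ^ 2) *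
        ∫ t in a..b, ∫ θ in (-Real.pi)..Real.pi, ‖u (t, θ)‖ ^ 2) :=
        mul_le_mul_of_nonneg_left hmain (by norm_num)
    _ = _ := by
        rw [mul_assoc]
        congr 2
        exact intervalIntegral.integral_congr fun t _ =>
          intervalIntegral.integral_congr fun θ _ => (hR t θ).symm
end

section
/- Let a ∈ [0,1/2] and ζ ∈ ℝ, and set C_{a,ζ} = min{ min_{ℓ∈ℤ}(a + ζ/2 − ℓ)² , min_{ℓ∈ℤ}(a − ζ/2 − ℓ)² }. Then for all φ, χ ∈ C_c^∞(ℝ²∖{0},ℂ), ∫_{ℝ²} |x|^ζ ( |D_a χ(x)|² + |D_a^* φ(x)|² ) dx ≥ C_{a,ζ} ∫_{ℝ²} |x|^{ζ−2} ( |φ(x)|² + |χ(x)|² ) dx. -/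
open MeasureTheory

/-- The magnetic operator `D_a χ = -2i ∂_z χ + i a (z̄/|z|²) χ`. -/
noncomputable def Dop (a : ℝ) (χ : ℂ → ℂ) (x : ℂ) : ℂ :=
  (-2) * Complex.I * wirtingerZ χ x
    + Complex.I * (a : ℂ) * ((starRingEnd ℂ) x / ((‖x‖ : ℂ)^2)) * χ x

/-- The magnetic operator `D_a^* φ = -2i ∂_{z̄} φ - i a (z/|z|²) φ`. -/
noncomputable def DopStar (a : ℝ) (φ : ℂ → ℂ) (x : ℂ) : ℂ :=
  (-2) * Complex.I * wirtingerZbar φ x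
    - Complex.I * (a : ℂ) * (x / ((‖x‖ : ℂ)^2)) * φ x

theorem fourierCoeffOn_deriv_of_periodic {u u' : ℝ → ℂ} (hu : ∀ θ, HasDerivAt u (u' θ) θ)
    (hu' : Continuous u') (hper : u (2 * Real.pi) = u 0) (n : ℤ) :
    fourierCoeffOn Real.two_pi_pos u' n = Complex.I * n * fourierCoeffOn Real.two_pi_pos u n := by
  rcases eq_or_ne n 0 with rfl | hn
  · rw [fourierCoeffOn_eq_integral]
    simp [intervalIntegral.integral_eq_sub_of_hasDerivAt (fun x _ => hu x)
      (hu'.intervalIntegrable _ _), hper]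
  · rw [fourierCoeffOn_of_hasDerivAt Real.two_pi_pos hn (fun x _ => hu x)
      (hu'.intervalIntegrable _ _), hper]
    have : (n : ℂ) ≠ 0 := by exact_mod_cast hn
    have h2 : (Real.pi : ℂ) ≠ 0 := by exact_mod_cast Real.pi_ne_zero
    push_cast
    have := Complex.I_ne_zero
    field_simp
    simp
    ring

theorem le_integral_norm_sq_I_mul_deriv_add {u u' : ℝ → ℂ} {b C : ℝ}
    (hC : ∀ n : ℤ, C ≤ (b - n) ^ 2) (hu : ∀ θ, HasDerivAt u (u' θ) θ)
    (hu' : Continuous u') (hper : u (2 * Real.pi) = u 0) :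
    C * ∫ θ in (0 : ℝ)..(2 * Real.pi), ‖u θ‖ ^ 2 ≤
      ∫ θ in (0 : ℝ)..(2 * Real.pi), ‖Complex.I * u' θ + b * u θ‖ ^ 2 := by
  have hucont : Continuous u := continuous_iff_continuousAt.2 fun θ => (hu θ).continuousAt
  have hL2 : ∀ f : ℝ → ℂ, Continuous f →
      MemLp f 2 (volume.restrict (Set.Ioc 0 (2 * Real.pi))) := by
    intro f hf
    rw [memLp_two_iff_integrable_sq_norm hf.aestronglyMeasurable]
    exact (Continuous.integrableOn_Icc (by fun_prop)).mono_set Set.Ioc_subset_Icc_self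
  have hcoeff (n : ℤ) : fourierCoeffOn Real.two_pi_pos (fun θ => Complex.I * u' θ + b * u θ) n =
      (b - n) * fourierCoeffOn Real.two_pi_pos u n := by
    have hadd : fourierCoeffOn Real.two_pi_pos (fun θ => Complex.I * u' θ + b * u θ) n =
        fourierCoeffOn Real.two_pi_pos (fun θ => Complex.I * u' θ) n +
        fourierCoeffOn Real.two_pi_pos (fun θ => b * u θ) n := by
      simp only [fourierCoeffOn_eq_integral]
      rw [← smul_add, ← intervalIntegral.integral_add]
      · simp only [smul_add]
      all_goals
        refine Continuous.intervalIntegrable ?_ _ _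
        refine Continuous.smul (((map_continuous (fourier (-n))).comp
          (AddCircle.continuous_mk' _))) ?_
        fun_prop
    rw [hadd, fourierCoeffOn.const_mul, fourierCoeffOn.const_mul,
      fourierCoeffOn_deriv_of_periodic hu hu' hper]
    linear_combination (n : ℂ) * fourierCoeffOn Real.two_pi_pos u n * Complex.I_sq
  have h1 := hasSum_sq_fourierCoeffOn Real.two_pi_pos (hL2 u hucont)
  have h2 := hasSum_sq_fourierCoeffOn Real.two_pi_pos
    (hL2 (fun θ => Complex.I * u' θ + b * u θ) (by fun_prop))
  have h3 := hasSum_le (fun n => ?_) (h1.mul_left C) h2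
  · simp only [smul_eq_mul, sub_zero] at h3
    have hp := Real.two_pi_pos
    rw [mul_left_comm] at h3
    exact le_of_mul_le_mul_left h3 (inv_pos.2 hp)
  · rw [hcoeff, norm_mul, mul_pow]
    have : ‖(b : ℂ) - n‖ ^ 2 = (b - n) ^ 2 := by
      rw [show (b : ℂ) - n = ((b - n : ℝ) : ℂ) by push_cast; rfl, Complex.norm_real,
        Real.norm_eq_abs, sq_abs]
    rw [this]
    exact mul_le_mul_of_nonneg_right (hC n) (sq_nonneg _)

theorem integrable_of_continuousOn_compact {E : Type*} [NormedAddCommGroup E] {f : ℂ → E}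
    {K : Set ℂ} (hK : IsCompact K) (hf : ContinuousOn f K) (h0 : ∀ x ∉ K, f x = 0) :
    Integrable f := by
  rw [← integrableOn_iff_integrable_of_support_subset (s := K)]
  · exact hf.integrableOn_compact hK
  · intro x hx
    by_contra h
    exact hx (h0 x h)

theorem integral_nonneg_of_circle_integral_nonneg {f : ℂ → ℝ} (hf : Integrable f)
    (h : ∀ x, 0 ≤ ∫ θ in (0 : ℝ)..(2 * Real.pi), f (Circle.exp θ * x)) : 0 ≤ ∫ x, f x := by
  set μ : Measure ℝ := volume.restrict (Set.Ioc 0 (2 * Real.pi))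
  have hrot (θ : ℝ) : MeasurePreserving (fun x : ℂ => (Circle.exp θ : ℂ) * x) :=
    (rotation (Circle.exp θ)).measurePreserving
  have hrotint (θ : ℝ) : ∫ x, f (Circle.exp θ * x) = ∫ x, f x :=
    (hrot θ).integral_comp (rotation (Circle.exp θ)).toHomeomorph.measurableEmbedding f
  have hskew : MeasurePreserving (fun p : ℝ × ℂ => (p.1, (Circle.exp p.1 : ℂ) * p.2))
      (μ.prod volume) (μ.prod volume) := by
    refine (MeasurePreserving.id μ).skew_product (g := fun θ x => (Circle.exp θ : ℂ) * x) ?_ ?_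
    · fun_prop
    · exact Filter.Eventually.of_forall fun θ => (hrot θ).map_eq
  have hint : Integrable (Function.uncurry fun (θ : ℝ) (x : ℂ) => f (Circle.exp θ * x))
      (μ.prod volume) :=
    hskew.integrable_comp_of_integrable (hf.comp_snd μ)
  have hswap := integral_integral_swap hint
  simp only [hrotint] at hswap
  rw [integral_const] at hswap
  have hμ : μ.real Set.univ = 2 * Real.pi := by
    simp [μ, Measure.real, Real.pi_pos.le]
  rw [hμ] at hswap
  have : 0 ≤ (2 * Real.pi) • ∫ x, f x := by
    rw [hswap]
    refine integral_nonneg fun x => ?_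
    have := h x
    rwa [intervalIntegral.integral_of_le Real.two_pi_pos.le] at this
  exact nonneg_of_mul_nonneg_right (by simpa using this) Real.two_pi_pos

theorem ne_zero_of_mem_tsupport {ψ : ℂ → ℂ} (h0 : (0 : ℂ) ∉ tsupport ψ) {x : ℂ}
    (hx : x ∈ tsupport ψ) : x ≠ 0 := by
  rintro rfl
  exact h0 hx

theorem le_integral_angular {ψ : ℂ → ℂ} (hψ : ContDiff ℝ 1 ψ) (hc : HasCompactSupport ψ)
    (h0 : (0 : ℂ) ∉ tsupport ψ) {b C : ℝ} (hC : ∀ n : ℤ, C ≤ (b - n) ^ 2) :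
    C * ∫ x : ℂ, ‖ψ x‖ ^ 2 / ‖x‖ ^ 2 ≤
      ∫ x : ℂ, ‖Complex.I * fderiv ℝ ψ x (Complex.I * x) + b * ψ x‖ ^ 2 / ‖x‖ ^ 2 := by
  have hne : ∀ x ∈ tsupport ψ, ‖x‖ ^ 2 ≠ 0 := fun x hx =>
    pow_ne_zero 2 (norm_ne_zero_iff.2 (ne_zero_of_mem_tsupport h0 hx))
  have hcf : Continuous (fderiv ℝ ψ) := hψ.continuous_fderiv one_ne_zero
  have hcψ := hψ.continuous
  have h1 : Integrable fun x : ℂ => ‖ψ x‖ ^ 2 / ‖x‖ ^ 2 := by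
    refine integrable_of_continuousOn_compact hc ?_ ?_
    · exact ContinuousOn.div (by fun_prop) (by fun_prop) hne
    · intro x hx
      simp [image_eq_zero_of_notMem_tsupport hx]
  have h2 : Integrable fun x : ℂ =>
      ‖Complex.I * fderiv ℝ ψ x (Complex.I * x) + b * ψ x‖ ^ 2 / ‖x‖ ^ 2 := by
    refine integrable_of_continuousOn_compact hc ?_ ?_
    · refine ContinuousOn.div (Continuous.continuousOn ?_) (by fun_prop) hne
      fun_prop
    · intro x hx
      simp [image_eq_zero_of_notMem_tsupport hx, fderiv_of_notMem_tsupport ℝ hx]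
  have key := integral_nonneg_of_circle_integral_nonneg (h2.sub (h1.const_mul C)) ?_
  · simp only [Pi.sub_apply] at key
    rw [integral_sub h2 (h1.const_mul C), integral_const_mul] at key
    linarith
  · intro x
    have hexp (θ : ℝ) : HasDerivAt (fun θ : ℝ => (Circle.exp θ : ℂ) * x)
        (Complex.I * ((Circle.exp θ : ℂ) * x)) θ := by
      have h := ((Complex.ofRealCLM.hasDerivAt (x := θ)).mul_const Complex.I).cexp.mul_const x
      simp only [Circle.coe_exp]
      exact h.congr_deriv (by simp [mul_comm, mul_left_comm])
    have hu (θ : ℝ) : HasDerivAt (fun θ : ℝ => ψ ((Circle.exp θ : ℂ) * x))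
        (fderiv ℝ ψ (Circle.exp θ * x) (Complex.I * (Circle.exp θ * x))) θ :=
      (hψ.differentiable one_ne_zero _).hasFDerivAt.comp_hasDerivAt θ (hexp θ)
    have hineq := le_integral_norm_sq_I_mul_deriv_add hC hu (by fun_prop)
      (by simp)
    simp only [Pi.sub_apply, norm_mul, Circle.norm_coe, one_mul]
    rw [intervalIntegral.integral_sub, intervalIntegral.integral_div,
      intervalIntegral.integral_const_mul, intervalIntegral.integral_div, ← mul_div_assoc,
      ← sub_div]
    · exact div_nonneg (sub_nonneg.2 hineq) (sq_nonneg _)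
    · exact Continuous.intervalIntegrable (by fun_prop) _ _
    · exact Continuous.intervalIntegrable (by fun_prop) _ _

theorem integral_im_conj_fderiv_mul_fderiv {ψ : ℂ → ℂ} (hψ : ContDiff ℝ 2 ψ)
    (hc : HasCompactSupport ψ) (v w : ℂ) :
    ∫ x : ℂ, ((starRingEnd ℂ) (fderiv ℝ ψ x v) * fderiv ℝ ψ x w).im = 0 := by
  have hd : Differentiable ℝ ψ := hψ.differentiable two_ne_zero
  have hf1 : ContDiff ℝ 1 (fderiv ℝ ψ) := hψ.fderiv_right (by norm_num)
  have hfv (v : ℂ) : ContDiff ℝ 1 fun x => fderiv ℝ ψ x v := by fun_prop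
  have hconj : ContDiff ℝ 2 fun x => (starRingEnd ℂ) (ψ x) := Complex.conjCLE.contDiff.comp hψ
  have hconjd (x v : ℂ) : fderiv ℝ (fun x => (starRingEnd ℂ) (ψ x)) x v =
      (starRingEnd ℂ) (fderiv ℝ ψ x v) := by
    have := (Complex.conjCLE.hasFDerivAt (x := ψ x)).comp x (hd x).hasFDerivAt
    exact congrArg (fun L => L v) this.fderiv
  have hcont (v : ℂ) := (hfv v).continuous
  have hcψ := hψ.continuous
  have hc2 (v w : ℂ) : Continuous fun x => fderiv ℝ (fun x => fderiv ℝ ψ x v) x w := by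
    have := (hfv v).continuous_fderiv one_ne_zero
    fun_prop
  have hint (v w : ℂ) :
      Integrable fun x => (starRingEnd ℂ) (fderiv ℝ ψ x v) * fderiv ℝ ψ x w := by
    refine integrable_of_continuousOn_compact hc (Continuous.continuousOn ?_) ?_
    · exact (Complex.continuous_conj.comp (hcont v)).mul (hcont w)
    · intro x hx
      simp [fderiv_of_notMem_tsupport ℝ hx]
  have hint2 (v w : ℂ) :
      Integrable fun x => (starRingEnd ℂ) (ψ x) * fderiv ℝ (fun x => fderiv ℝ ψ x v) x w := by
    refine integrable_of_continuousOn_compact hc (Continuous.continuousOn ?_) ?_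
    · exact (Complex.continuous_conj.comp hcψ).mul (hc2 v w)
    · intro x hx
      simp [image_eq_zero_of_notMem_tsupport hx]
  have hint3 (v : ℂ) :
      Integrable fun x => (starRingEnd ℂ) (ψ x) * fderiv ℝ ψ x v := by
    refine integrable_of_continuousOn_compact hc (Continuous.continuousOn ?_) ?_
    · exact (Complex.continuous_conj.comp hcψ).mul (hcont v)
    · intro x hx
      simp [image_eq_zero_of_notMem_tsupport hx]
  have hibp (v w : ℂ) : ∫ x, (starRingEnd ℂ) (fderiv ℝ ψ x v) * fderiv ℝ ψ x w =
      -∫ x, (starRingEnd ℂ) (ψ x) * fderiv ℝ (fun x => fderiv ℝ ψ x w) x v := by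
    rw [integral_mul_fderiv_eq_neg_fderiv_mul_of_integrable (v := v)
      (f := fun x => (starRingEnd ℂ) (ψ x)) (g := fun x => fderiv ℝ ψ x w)]
    · simp only [hconjd, neg_neg]
    · simpa only [hconjd] using hint v w
    · exact hint2 w v
    · exact hint3 w
    · exact fun x _ => hconj.differentiable two_ne_zero x
    · exact fun x _ => (hfv w).differentiable one_ne_zero x
  have hsymm (x : ℂ) : fderiv ℝ (fun x => fderiv ℝ ψ x v) x w =
      fderiv ℝ (fun x => fderiv ℝ ψ x w) x v := by
    have h := (hψ.contDiffAt (x := x)).isSymmSndFDerivAt (by simp) v w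
    have hdf := hf1.differentiable one_ne_zero x
    rw [fderiv_clm_apply hdf (by fun_prop), fderiv_clm_apply hdf (by fun_prop)]
    simp [h]
  have hvw : ∫ x, (starRingEnd ℂ) (fderiv ℝ ψ x v) * fderiv ℝ ψ x w =
      ∫ x, (starRingEnd ℂ) (fderiv ℝ ψ x w) * fderiv ℝ ψ x v := by
    rw [hibp v w, hibp w v]
    simp only [hsymm]
  have hconjint : (starRingEnd ℂ) (∫ x, (starRingEnd ℂ) (fderiv ℝ ψ x v) * fderiv ℝ ψ x w) =
      ∫ x, (starRingEnd ℂ) (fderiv ℝ ψ x v) * fderiv ℝ ψ x w := by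
    rw [← integral_conj]
    conv_rhs => rw [hvw]
    simp [mul_comm]
  have him := Complex.conj_eq_iff_im.1 hconjint
  rw [← him]
  exact integral_im (hint v w)

theorem integral_inv_mul_fderiv_add_I_mul_fderiv {N : ℂ → ℂ} (hN : ContDiff ℝ 1 N)
    (hc : HasCompactSupport N) (h0 : (0 : ℂ) ∉ tsupport N) :
    ∫ x : ℂ, x⁻¹ * (fderiv ℝ N x 1 + Complex.I * fderiv ℝ N x Complex.I) = 0 := by
  have hne : ∀ x ∈ tsupport N, x ≠ 0 := fun x hx => ne_zero_of_mem_tsupport h0 hx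
  have hinv : ContinuousOn (fun x : ℂ => x⁻¹) (tsupport N) := continuousOn_inv₀.mono hne
  have hderiv (x v : ℂ) (hx : x ≠ 0) :
      fderiv ℝ (fun x : ℂ => x⁻¹) x v = -(x ^ 2)⁻¹ * v := by
    have h := (hasDerivAt_inv hx).hasFDerivAt.restrictScalars ℝ
    rw [h.fderiv]
    simp [mul_comm]
  have hNv (v : ℂ) : Continuous fun x => fderiv ℝ N x v := by
    have := hN.continuous_fderiv one_ne_zero
    fun_prop
  have hint1 (v : ℂ) : Integrable fun x => x⁻¹ * fderiv ℝ N x v := by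
    refine integrable_of_continuousOn_compact hc (hinv.mul (hNv v).continuousOn) ?_
    intro x hx
    simp [fderiv_of_notMem_tsupport ℝ hx]
  have hcongr (v : ℂ) : (fun x => fderiv ℝ (fun x : ℂ => x⁻¹) x v * N x) =
      fun x => -(x⁻¹ ^ 2 * N x) * v := by
    ext x
    by_cases hx : x ∈ tsupport N
    · rw [hderiv x v (hne x hx)]
      ring
    · simp [image_eq_zero_of_notMem_tsupport hx]
  have hint2 : Integrable fun x => x⁻¹ ^ 2 * N x := by
    refine integrable_of_continuousOn_compact hc ((hinv.pow 2).mul hN.continuous.continuousOn) ?_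
    intro x hx
    simp [image_eq_zero_of_notMem_tsupport hx]
  have hibp (v : ℂ) : ∫ x, x⁻¹ * fderiv ℝ N x v = (∫ x, x⁻¹ ^ 2 * N x) * v := by
    rw [integral_mul_fderiv_eq_neg_fderiv_mul_of_integrable (f := fun x : ℂ => x⁻¹), hcongr,
      integral_mul_const, integral_neg]
    · ring
    · rw [hcongr]
      exact hint2.neg.mul_const v
    · exact hint1 v
    · refine integrable_of_continuousOn_compact hc (hinv.mul hN.continuous.continuousOn) ?_
      intro x hx
      simp [image_eq_zero_of_notMem_tsupport hx]
    · intro x hx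
      exact ((hasDerivAt_inv (hne x hx)).hasFDerivAt.restrictScalars ℝ).differentiableAt
    · exact fun x _ => hN.differentiable one_ne_zero x
  simp only [mul_add, mul_left_comm _ Complex.I]
  rw [integral_add (hint1 1) ((hint1 Complex.I).const_mul _), integral_const_mul, hibp, hibp]
  linear_combination (∫ x, x⁻¹ ^ 2 * N x) * Complex.I_sq

theorem norm_DopStar (b : ℝ) (ψ : ℂ → ℂ) (x : ℂ) :
    ‖DopStar b ψ x‖ =
      ‖fderiv ℝ ψ x 1 + Complex.I * fderiv ℝ ψ x Complex.I + b * (x / (‖x‖ : ℂ) ^ 2) * ψ x‖ := by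
  rw [← one_mul ‖fderiv ℝ ψ x 1 + _ + _‖, ← Complex.norm_I, ← norm_mul, ← norm_neg, DopStar,
    wirtingerZbar]
  congr 1
  ring

theorem norm_Dop (a : ℝ) {χ : ℂ → ℂ} (hχ : Differentiable ℝ χ) (x : ℂ) :
    ‖Dop a χ x‖ = ‖DopStar (-a) (fun y => (starRingEnd ℂ) (χ y)) x‖ := by
  have hconjd (v : ℂ) : fderiv ℝ (fun x => (starRingEnd ℂ) (χ x)) x v =
      (starRingEnd ℂ) (fderiv ℝ χ x v) := by
    have := (Complex.conjCLE.hasFDerivAt (x := χ x)).comp x (hχ x).hasFDerivAt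
    exact congrArg (fun L => L v) this.fderiv
  rw [norm_DopStar, hconjd, hconjd, ← RCLike.norm_conj, ← one_mul ‖(starRingEnd ℂ) (Dop a χ x)‖,
    ← Complex.norm_I, ← norm_mul, ← norm_neg, Dop, wirtingerZ]
  congr 1
  simp only [map_add, map_mul, map_sub, map_neg, map_div₀, map_pow, map_one, map_ofNat,
    Complex.conj_I, Complex.conj_ofReal, Complex.conj_conj, Complex.ofReal_neg]
  linear_combination
    (-(starRingEnd ℂ) (fderiv ℝ χ x 1) - Complex.I * (starRingEnd ℂ) (fderiv ℝ χ x Complex.I)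
      + a * (x / (‖x‖ : ℂ) ^ 2) * (starRingEnd ℂ) (χ x)) * Complex.I_sq

theorem continuousOn_DopStar (b : ℝ) {ψ : ℂ → ℂ} (hψ : ContDiff ℝ 1 ψ)
    (h0 : (0 : ℂ) ∉ tsupport ψ) : ContinuousOn (DopStar b ψ) (tsupport ψ) := by
  have hcf : Continuous (fderiv ℝ ψ) := hψ.continuous_fderiv one_ne_zero
  have hcψ := hψ.continuous
  have hq : ContinuousOn (fun x : ℂ => x / (‖x‖ : ℂ) ^ 2) (tsupport ψ) := by
    refine ContinuousOn.div (by fun_prop) (by fun_prop) fun x hx => ?_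
    simpa using ne_zero_of_mem_tsupport h0 hx
  unfold DopStar wirtingerZbar
  refine ContinuousOn.sub (by fun_prop) ?_
  exact (continuousOn_const.mul hq).mul hcψ.continuousOn

theorem DopStar_of_notMem_tsupport (b : ℝ) {ψ : ℂ → ℂ} {x : ℂ} (hx : x ∉ tsupport ψ) :
    DopStar b ψ x = 0 := by
  simp [DopStar, wirtingerZbar, image_eq_zero_of_notMem_tsupport hx,
    fderiv_of_notMem_tsupport ℝ hx]

theorem norm_sq_DopStar (b : ℝ) {ψ : ℂ → ℂ} (hψ : Differentiable ℝ ψ) {x : ℂ} (hx : x ≠ 0) :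
    ‖DopStar b ψ x‖ ^ 2 = ‖fderiv ℝ ψ x x‖ ^ 2 / ‖x‖ ^ 2
      + ‖Complex.I * fderiv ℝ ψ x (Complex.I * x) + b * ψ x‖ ^ 2 / ‖x‖ ^ 2
      - 2 * ((starRingEnd ℂ) (fderiv ℝ ψ x 1) * fderiv ℝ ψ x Complex.I).im
      + b * (x⁻¹ * (fderiv ℝ (fun y => (starRingEnd ℂ) (ψ y) * ψ y) x 1
          + Complex.I * fderiv ℝ (fun y => (starRingEnd ℂ) (ψ y) * ψ y) x Complex.I)).re := by
  have hN (v : ℂ) : fderiv ℝ (fun y => (starRingEnd ℂ) (ψ y) * ψ y) x v =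
      (starRingEnd ℂ) (fderiv ℝ ψ x v) * ψ x + (starRingEnd ℂ) (ψ x) * fderiv ℝ ψ x v := by
    have h1 := (Complex.conjCLE.hasFDerivAt (x := ψ x)).comp x (hψ x).hasFDerivAt
    have h2 := (h1.mul (hψ x).hasFDerivAt).fderiv
    have h3 := congrArg (fun L => L v) h2
    refine h3.trans ?_
    simp
    ring
  have hE : fderiv ℝ ψ x x = x.re * fderiv ℝ ψ x 1 + x.im * fderiv ℝ ψ x Complex.I := by
    conv_lhs => rw [show x = x.re • (1 : ℂ) + x.im • Complex.I by simp [Complex.re_add_im]]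
    rw [map_add, map_smul, map_smul]
    simp [Complex.re_add_im]
  have hT : fderiv ℝ ψ x (Complex.I * x) =
      x.re * fderiv ℝ ψ x Complex.I - x.im * fderiv ℝ ψ x 1 := by
    have : Complex.I * x = x.re • Complex.I - x.im • (1 : ℂ) := by
      apply Complex.ext <;> simp
    rw [this, map_sub, map_smul, map_smul]
    simp
  rw [norm_DopStar, hE, hT, hN, hN]
  generalize fderiv ℝ ψ x 1 = P
  generalize fderiv ℝ ψ x Complex.I = Q
  generalize ψ x = z
  have hr : x.re ^ 2 + x.im ^ 2 ≠ 0 := by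
    have := Complex.normSq_pos.2 hx
    rw [Complex.normSq_apply, ← sq, ← sq] at this
    exact this.ne'
  have hx2 : (‖x‖ : ℂ) ^ 2 = ((x.re ^ 2 + x.im ^ 2 : ℝ) : ℂ) := by
    rw [← Complex.ofReal_pow, Complex.sq_norm, Complex.normSq_apply, sq, sq]
  rw [hx2, Complex.inv_def, div_eq_mul_inv, ← Complex.ofReal_inv]
  simp only [Complex.sq_norm, Complex.normSq_apply, Complex.add_re, Complex.add_im,
    Complex.sub_re, Complex.sub_im, Complex.mul_re, Complex.mul_im, Complex.I_re, Complex.I_im,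
    Complex.ofReal_re, Complex.ofReal_im, Complex.conj_re, Complex.conj_im, ← sq]
  field_simp
  ring

theorem le_integral_norm_sq_DopStar {ψ : ℂ → ℂ} (hψ : ContDiff ℝ 2 ψ) (hc : HasCompactSupport ψ)
    (h0 : (0 : ℂ) ∉ tsupport ψ) {b C : ℝ} (hC : ∀ n : ℤ, C ≤ (b - n) ^ 2) :
    C * ∫ x : ℂ, ‖ψ x‖ ^ 2 / ‖x‖ ^ 2 ≤ ∫ x : ℂ, ‖DopStar b ψ x‖ ^ 2 := by
  have hψ1 : ContDiff ℝ 1 ψ := hψ.of_le (by norm_num)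
  have hd : Differentiable ℝ ψ := hψ.differentiable two_ne_zero
  have hcf : Continuous (fderiv ℝ ψ) := hψ1.continuous_fderiv one_ne_zero
  have hcψ := hψ.continuous
  have hne : ∀ x ∈ tsupport ψ, ‖x‖ ^ 2 ≠ 0 := fun x hx =>
    pow_ne_zero 2 (norm_ne_zero_iff.2 (ne_zero_of_mem_tsupport h0 hx))
  set N : ℂ → ℂ := fun y => (starRingEnd ℂ) (ψ y) * ψ y with hNdef
  have hN : ContDiff ℝ 1 N := (Complex.conjCLE.contDiff.comp hψ1).mul hψ1
  have hNsub : tsupport N ⊆ tsupport ψ := tsupport_mul_subset_right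
  have hNc : HasCompactSupport N := hc.of_isClosed_subset (isClosed_tsupport _) hNsub
  have hcN : Continuous (fderiv ℝ N) := hN.continuous_fderiv one_ne_zero
  have hD : Integrable fun x => ‖DopStar b ψ x‖ ^ 2 := by
    refine integrable_of_continuousOn_compact hc
      ((continuousOn_DopStar b hψ1 h0).norm.pow 2) fun x hx => ?_
    simp [DopStar_of_notMem_tsupport b hx]
  have hA : Integrable fun x : ℂ =>
      ‖Complex.I * fderiv ℝ ψ x (Complex.I * x) + b * ψ x‖ ^ 2 / ‖x‖ ^ 2 := by
    refine integrable_of_continuousOn_compact hc ?_ ?_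
    · refine ContinuousOn.div (Continuous.continuousOn ?_) (by fun_prop) hne
      fun_prop
    · intro x hx
      simp [image_eq_zero_of_notMem_tsupport hx, fderiv_of_notMem_tsupport ℝ hx]
  have hJ : Integrable fun x : ℂ =>
      ((starRingEnd ℂ) (fderiv ℝ ψ x 1) * fderiv ℝ ψ x Complex.I).im := by
    refine integrable_of_continuousOn_compact hc (Continuous.continuousOn ?_) ?_
    · fun_prop
    · intro x hx
      simp [fderiv_of_notMem_tsupport ℝ hx]
  have hR : Integrable fun x : ℂ =>
      x⁻¹ * (fderiv ℝ N x 1 + Complex.I * fderiv ℝ N x Complex.I) := by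
    refine integrable_of_continuousOn_compact hc
      (ContinuousOn.mul ?_ (Continuous.continuousOn ?_)) ?_
    · exact continuousOn_inv₀.mono fun x hx => ne_zero_of_mem_tsupport h0 hx
    · fun_prop
    · intro x hx
      simp [fderiv_of_notMem_tsupport ℝ fun h => hx (hNsub h)]
  have hR0 : ∫ x : ℂ, (x⁻¹ * (fderiv ℝ N x 1 + Complex.I * fderiv ℝ N x Complex.I)).re = 0 := by
    have := integral_re hR
    rw [integral_inv_mul_fderiv_add_I_mul_fderiv hN hNc fun h => h0 (hNsub h)] at this
    simpa using this
  have hRre : Integrable fun x : ℂ =>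
    (x⁻¹ * (fderiv ℝ N x 1 + Complex.I * fderiv ℝ N x Complex.I)).re := hR.re
  have hAJ : Integrable fun x : ℂ =>
      ‖Complex.I * fderiv ℝ ψ x (Complex.I * x) + b * ψ x‖ ^ 2 / ‖x‖ ^ 2
        - 2 * ((starRingEnd ℂ) (fderiv ℝ ψ x 1) * fderiv ℝ ψ x Complex.I).im :=
    hA.sub (hJ.const_mul 2)
  calc C * ∫ x : ℂ, ‖ψ x‖ ^ 2 / ‖x‖ ^ 2
      ≤ ∫ x : ℂ, ‖Complex.I * fderiv ℝ ψ x (Complex.I * x) + b * ψ x‖ ^ 2 / ‖x‖ ^ 2 :=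
        le_integral_angular hψ1 hc h0 hC
    _ = ∫ x : ℂ, (‖Complex.I * fderiv ℝ ψ x (Complex.I * x) + b * ψ x‖ ^ 2 / ‖x‖ ^ 2
          - 2 * ((starRingEnd ℂ) (fderiv ℝ ψ x 1) * fderiv ℝ ψ x Complex.I).im
          + b * (x⁻¹ * (fderiv ℝ N x 1 + Complex.I * fderiv ℝ N x Complex.I)).re) := by
        rw [integral_add hAJ (hRre.const_mul b),
          integral_sub hA (hJ.const_mul 2), integral_const_mul, integral_const_mul,
          integral_im_conj_fderiv_mul_fderiv hψ hc, hR0]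
        ring
    _ ≤ ∫ x : ℂ, ‖DopStar b ψ x‖ ^ 2 := by
        refine integral_mono (hAJ.add (hRre.const_mul b)) hD fun x => ?_
        by_cases hx : x ∈ tsupport ψ
        · have h := norm_sq_DopStar b hd (ne_zero_of_mem_tsupport h0 hx)
          have : 0 ≤ ‖fderiv ℝ ψ x x‖ ^ 2 / ‖x‖ ^ 2 := by positivity
          simp only [hNdef]
          linarith
        · simp [fderiv_of_notMem_tsupport ℝ hx, image_eq_zero_of_notMem_tsupport hx,
            fderiv_of_notMem_tsupport ℝ fun h => hx (hNsub h), DopStar_of_notMem_tsupport b hx]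

theorem hasFDerivAt_norm_rpow_of_ne_zero (s : ℝ) {x : ℂ} (hx : x ≠ 0) :
    HasFDerivAt (fun y : ℂ => ‖y‖ ^ s) ((s * ‖x‖ ^ (s - 2)) • innerSL ℝ x) x := by
  have hpos : 0 < ‖x‖ := norm_pos_iff.2 hx
  have h := (hasStrictFDerivAt_norm_sq x).hasFDerivAt.rpow_const (p := s / 2)
    (Or.inl (pow_ne_zero 2 hpos.ne'))
  have hpow (y : ℂ) (t : ℝ) : (‖y‖ ^ 2) ^ (t / 2) = ‖y‖ ^ t := by
    rw [← Real.rpow_natCast, ← Real.rpow_mul (norm_nonneg _)]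
    congr 1
    push_cast
    ring
  simp only [hpow] at h
  rw [show s / 2 - 1 = (s - 2) / 2 by ring, hpow, ← Nat.cast_smul_eq_nsmul ℝ, smul_smul] at h
  rw [show s * ‖x‖ ^ (s - 2) = s / 2 * ‖x‖ ^ (s - 2) * (2 : ℕ) by push_cast; ring]
  exact h

theorem DopStar_norm_rpow_smul (a s : ℝ) {φ : ℂ → ℂ} (hφ : Differentiable ℝ φ) {x : ℂ}
    (hx : x ≠ 0) :
    DopStar (a - s) (fun y => ‖y‖ ^ s • φ y) x = (‖x‖ ^ s : ℝ) * DopStar a φ x := by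
  have hpos : 0 < ‖x‖ := norm_pos_iff.2 hx
  have hf (v : ℂ) : fderiv ℝ (fun y => ‖y‖ ^ s • φ y) x v =
      (‖x‖ ^ s : ℝ) * fderiv ℝ φ x v
        + s * ((‖x‖ ^ s : ℝ) / (‖x‖ : ℂ) ^ 2) * (inner ℝ x v : ℝ) * φ x := by
    have h := ((hasFDerivAt_norm_rpow_of_ne_zero s hx).smul (hφ x).hasFDerivAt).fderiv
    refine (congrArg (fun L => L v) h).trans ?_
    have hp : ‖x‖ ^ (s - 2) = ‖x‖ ^ s / ‖x‖ ^ 2 := by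
      rw [Real.rpow_sub hpos, Real.rpow_two]
    simp [hp]
  have h1 : inner ℝ x 1 = x.re := by simp [Complex.inner]
  have h2 : inner ℝ x Complex.I = x.im := by simp [Complex.inner]
  simp only [DopStar, wirtingerZbar, hf, h1, h2]
  simp only [Complex.real_smul]
  have hx' := Complex.re_add_im x
  push_cast
  linear_combination (-Complex.I * s * ((‖x‖ ^ s : ℝ) / (‖x‖ : ℂ) ^ 2) * φ x) * hx'

theorem le_integral_norm_rpow_mul_norm_sq_DopStar {a ζ C : ℝ} {φ : ℂ → ℂ}
    (hφ : ContDiff ℝ 2 φ) (hc : HasCompactSupport φ) (h0 : (0 : ℂ) ∉ tsupport φ)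
    (hC : ∀ n : ℤ, C ≤ (a - ζ / 2 - n) ^ 2) :
    C * ∫ x : ℂ, ‖x‖ ^ (ζ - 2) * ‖φ x‖ ^ 2 ≤ ∫ x : ℂ, ‖x‖ ^ ζ * ‖DopStar a φ x‖ ^ 2 := by
  have hd : Differentiable ℝ φ := hφ.differentiable two_ne_zero
  set ψ : ℂ → ℂ := fun y => ‖y‖ ^ (ζ / 2) • φ y with hψdef
  have hsub : tsupport ψ ⊆ tsupport φ := tsupport_smul_subset_right _ _
  have hψ : ContDiff ℝ 2 ψ := by
    refine contDiff_iff_contDiffAt.2 fun x => ?_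
    by_cases hx : x ∈ tsupport ψ
    swap
    · exact contDiffAt_const.congr_of_eventuallyEq (notMem_tsupport_iff_eventuallyEq.1 hx)
    have hx0 := ne_zero_of_mem_tsupport h0 (hsub hx)
    exact ((contDiffAt_norm ℝ hx0).rpow_const_of_ne (norm_ne_zero_iff.2 hx0)).smul hφ.contDiffAt
  have hpow (x : ℂ) : (‖x‖ ^ (ζ / 2)) ^ 2 = ‖x‖ ^ ζ := by
    rw [← Real.rpow_natCast, ← Real.rpow_mul (norm_nonneg _)]
    congr 1
    push_cast
    ring
  have h := le_integral_norm_sq_DopStar hψ (hc.of_isClosed_subset (isClosed_tsupport _) hsub)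
    (fun h => h0 (hsub h)) hC
  have e1 : (fun x : ℂ => ‖ψ x‖ ^ 2 / ‖x‖ ^ 2) = fun x => ‖x‖ ^ (ζ - 2) * ‖φ x‖ ^ 2 := by
    ext x
    by_cases hx : x ∈ tsupport φ
    · have hx0 := ne_zero_of_mem_tsupport h0 hx
      rw [hψdef, norm_smul, mul_pow, Real.norm_of_nonneg (by positivity), hpow x,
        Real.rpow_sub (norm_pos_iff.2 hx0), Real.rpow_two]
      ring
    · simp [ψ, image_eq_zero_of_notMem_tsupport hx]
  have e2 : (fun x : ℂ => ‖DopStar (a - ζ / 2) ψ x‖ ^ 2) =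
      fun x => ‖x‖ ^ ζ * ‖DopStar a φ x‖ ^ 2 := by
    ext x
    by_cases hx : x ∈ tsupport φ
    · have hx0 := ne_zero_of_mem_tsupport h0 hx
      rw [DopStar_norm_rpow_smul a (ζ / 2) hd hx0, norm_mul, mul_pow, Complex.norm_real,
        Real.norm_of_nonneg (by positivity), hpow x]
    · simp [DopStar_of_notMem_tsupport a hx,
        DopStar_of_notMem_tsupport (a - ζ / 2) fun h => hx (hsub h)]
  rwa [e1, e2] at h

theorem integrable_norm_rpow_mul {f : ℂ → ℝ} {ψ : ℂ → ℂ} (s : ℝ) (hc : HasCompactSupport ψ)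
    (h0 : (0 : ℂ) ∉ tsupport ψ) (hf : ContinuousOn f (tsupport ψ))
    (hf0 : ∀ x ∉ tsupport ψ, f x = 0) : Integrable fun x : ℂ => ‖x‖ ^ s * f x := by
  refine integrable_of_continuousOn_compact hc (ContinuousOn.mul ?_ hf) fun x hx => ?_
  · exact continuousOn_id.norm.rpow_const fun x hx =>
      Or.inl (norm_ne_zero_iff.2 (ne_zero_of_mem_tsupport h0 hx))
  · rw [hf0 x hx, mul_zero]

theorem stmt2 (a ζ : ℝ) (ha : a ∈ Set.Icc (0 : ℝ) (1/2))
    (φ χ : ℂ → ℂ)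
    (hφs : ContDiff ℝ (⊤ : ℕ∞) φ) (hφc : HasCompactSupport φ) (hφ0 : (0 : ℂ) ∉ tsupport φ)
    (hχs : ContDiff ℝ (⊤ : ℕ∞) χ) (hχc : HasCompactSupport χ) (hχ0 : (0 : ℂ) ∉ tsupport χ) :
    ∫ x : ℂ, ‖x‖ ^ ζ * (‖Dop a χ x‖^2 + ‖DopStar a φ x‖^2) ≥
      (min (⨅ ℓ : ℤ, (a + ζ/2 - (ℓ : ℝ))^2) (⨅ ℓ : ℤ, (a - ζ/2 - (ℓ : ℝ))^2)) *
        ∫ x : ℂ, ‖x‖ ^ (ζ - 2) * (‖φ x‖^2 + ‖χ x‖^2) := by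
  have hφ2 : ContDiff ℝ 2 φ := contDiff_infty.1 hφs 2
  have hχ2 : ContDiff ℝ 2 χ := contDiff_infty.1 hχs 2
  set η : ℂ → ℂ := fun x => (starRingEnd ℂ) (χ x) with hη
  have hη2 : ContDiff ℝ 2 η := Complex.conjCLE.contDiff.comp hχ2
  have hηsub : tsupport η ⊆ tsupport χ :=
    tsupport_comp_subset (g := starRingEnd ℂ) (map_zero _) χ
  have hη0 : (0 : ℂ) ∉ tsupport η := fun h => hχ0 (hηsub h)
  have hηc : HasCompactSupport η := hχc.of_isClosed_subset (isClosed_tsupport _) hηsub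
  have hDop (x : ℂ) : ‖Dop a χ x‖ = ‖DopStar (-a) η x‖ :=
    norm_Dop a (hχ2.differentiable two_ne_zero) x
  have hnorm (x : ℂ) : ‖χ x‖ = ‖η x‖ := (RCLike.norm_conj (χ x)).symm
  set C := min (⨅ ℓ : ℤ, (a + ζ/2 - (ℓ : ℝ))^2) (⨅ ℓ : ℤ, (a - ζ/2 - (ℓ : ℝ))^2)
  have hC1 (n : ℤ) : C ≤ (a - ζ / 2 - n) ^ 2 :=
    (min_le_right _ _).trans (ciInf_le ⟨0, by rintro _ ⟨m, rfl⟩; positivity⟩ n)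
  have hC2 (n : ℤ) : C ≤ (-a - ζ / 2 - n) ^ 2 := by
    refine ((min_le_left _ _).trans
      (ciInf_le ⟨0, by rintro _ ⟨m, rfl⟩; positivity⟩ (-n))).trans_eq ?_
    push_cast
    ring
  have h1 := le_integral_norm_rpow_mul_norm_sq_DopStar hφ2 hφc hφ0 hC1
  have h2 := le_integral_norm_rpow_mul_norm_sq_DopStar hη2 hηc hη0 hC2
  have iφ := integrable_norm_rpow_mul (ζ - 2) hφc hφ0 (f := fun x => ‖φ x‖ ^ 2)
    (hφ2.continuous.norm.pow 2).continuousOn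
    fun x hx => by simp [image_eq_zero_of_notMem_tsupport hx]
  have iη := integrable_norm_rpow_mul (ζ - 2) hηc hη0 (f := fun x => ‖η x‖ ^ 2)
    (hη2.continuous.norm.pow 2).continuousOn
    fun x hx => by simp [image_eq_zero_of_notMem_tsupport hx]
  have iDφ := integrable_norm_rpow_mul ζ hφc hφ0 (f := fun x => ‖DopStar a φ x‖ ^ 2)
    ((continuousOn_DopStar a (hφ2.of_le (by norm_num)) hφ0).norm.pow 2)
    fun x hx => by simp [DopStar_of_notMem_tsupport a hx]
  have iDη := integrable_norm_rpow_mul ζ hηc hη0 (f := fun x => ‖DopStar (-a) η x‖ ^ 2)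
    ((continuousOn_DopStar (-a) (hη2.of_le (by norm_num)) hη0).norm.pow 2)
    fun x hx => by simp [DopStar_of_notMem_tsupport (-a) hx]
  simp only [hDop, hnorm, mul_add]
  rw [integral_add iDη iDφ, integral_add iφ iη, mul_add]
  linarith
end

section
/- Let a ∈ [0,1/2] and ζ ∈ ℝ, and set C_{a,ζ} = min{ min_{ℓ∈ℤ}(a + ζ/2 − ℓ)² , min_{ℓ∈ℤ}(a − ζ/2 − ℓ)² }. If C ∈ ℝ is a constant such that ∫_{ℝ²} |x|^ζ ( |D_a χ(x)|² + |D_a^* φ(x)|² ) dx ≥ C ∫_{ℝ²} |x|^{ζ−2} ( |φ(x)|² + |χ(x)|² ) dx holds for all φ, χ ∈ C_c^∞(ℝ²∖{0},ℂ), then C ≤ C_{a,ζ}. In other words, C_{a,ζ} is the optimal constant in the magnetic Pauli Hardy inequality. -/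
open MeasureTheory

open Real in
/-- The function `H (log r) z ^ ℓ`, a radial profile carrying angular momentum `ℓ`. -/
noncomputable def angularMode (H : ℝ → ℝ) (ℓ : ℤ) (x : ℂ) : ℂ :=
  (H (log ‖x‖) : ℂ) * x ^ ℓ

theorem hasFDerivAt_log_norm {E : Type*} [NormedAddCommGroup E] [InnerProductSpace ℝ E]
    {x : E} (hx : x ≠ 0) :
    HasFDerivAt (fun y : E => Real.log ‖y‖) ((‖x‖ ^ 2)⁻¹ • innerSL ℝ x) x := by
  have hsq : HasFDerivAt (fun y : E => ‖y‖ ^ 2) (2 • innerSL ℝ x) x :=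
    (hasStrictFDerivAt_norm_sq x).hasFDerivAt
  have h := (hsq.log (by simpa using hx)).const_mul (1 / 2 : ℝ)
  refine (h.congr_fderiv ?_).congr_of_eventuallyEq (.of_forall fun y => ?_)
  · ext v
    simp
    ring
  · simp only [Real.log_pow]
    push_cast
    ring

theorem hasFDerivAt_angularMode {H : ℝ → ℝ} {H' : ℝ} (ℓ : ℤ) {x : ℂ} (hx : x ≠ 0)
    (hH : HasDerivAt H H' (Real.log ‖x‖)) :
    ∃ L : ℂ →L[ℝ] ℂ, HasFDerivAt (angularMode H ℓ) L x ∧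
      ∀ v : ℂ, L v = ((H' * ((‖x‖ ^ 2)⁻¹ * inner ℝ x v) : ℝ) : ℂ) * x ^ ℓ
        + (H (Real.log ‖x‖) : ℂ) * (ℓ * x ^ (ℓ - 1) * v) := by
  have h₁ := hH.comp_hasFDerivAt x (hasFDerivAt_log_norm hx)
  have h₂ := Complex.ofRealCLM.hasFDerivAt.comp x h₁
  have h₃ := ((hasDerivAt_zpow ℓ x (Or.inl hx)).hasFDerivAt).restrictScalars ℝ
  refine ⟨_, h₂.mul h₃, fun v => ?_⟩
  simp
  ring

theorem norm_DopStar_angularMode (a : ℝ) {H : ℝ → ℝ} {H' : ℝ} (ℓ : ℤ) {x : ℂ} (hx : x ≠ 0)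
    (hH : HasDerivAt H H' (Real.log ‖x‖)) :
    ‖DopStar a (angularMode H ℓ) x‖ = ‖x‖ ^ (ℓ - 1) * |H' + a * H (Real.log ‖x‖)| := by
  obtain ⟨L, hL, hLv⟩ := hasFDerivAt_angularMode ℓ hx hH
  have hn : (‖x‖ : ℂ) ≠ 0 := by simpa using hx
  have key : DopStar a (angularMode H ℓ) x
      = -Complex.I * (x ^ ℓ * x / (‖x‖ : ℂ) ^ 2) * ((H' + a * H (Real.log ‖x‖) : ℝ) : ℂ) := by
    have hre : (inner ℝ x (1 : ℂ) : ℝ) = x.re := by simp [Complex.inner]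
    have him : (inner ℝ x Complex.I : ℝ) = x.im := by simp [Complex.inner]
    rw [DopStar, wirtingerZbar, hL.fderiv, hLv, hLv, hre, him, angularMode]
    generalize H (Real.log ‖x‖) = h
    generalize x ^ (ℓ - 1) = w
    generalize x ^ ℓ = u
    push_cast
    field_simp
    linear_combination (-(H' : ℂ) * u) * Complex.re_add_im x
      - (h * w * ℓ * (‖x‖ : ℂ) ^ 2) * Complex.I_sq
  rw [key, norm_mul, norm_mul, norm_div, norm_mul, norm_zpow, Complex.norm_real, norm_neg,
    Complex.norm_I, norm_pow, Complex.norm_real, norm_norm, Real.norm_eq_abs,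
    zpow_sub_one₀ (by simpa using hx)]
  have : ‖x‖ ≠ 0 := by simpa using hx
  field_simp

theorem norm_Dop_angularMode (a : ℝ) {H : ℝ → ℝ} {H' : ℝ} (ℓ : ℤ) {x : ℂ} (hx : x ≠ 0)
    (hH : HasDerivAt H H' (Real.log ‖x‖)) :
    ‖Dop a (angularMode H ℓ) x‖
      = ‖x‖ ^ (ℓ - 1) * |H' + (2 * ℓ - a) * H (Real.log ‖x‖)| := by
  obtain ⟨L, hL, hLv⟩ := hasFDerivAt_angularMode ℓ hx hH
  have hconj : (starRingEnd ℂ) x = x.re - x.im * Complex.I := by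
    apply Complex.ext <;> simp
  have hinv : x⁻¹ = (starRingEnd ℂ) x / (‖x‖ : ℂ) ^ 2 := by
    rw [Complex.inv_def, Complex.normSq_eq_norm_sq]
    push_cast
    rfl
  have key : Dop a (angularMode H ℓ) x
      = -Complex.I * x ^ (ℓ - 1) * ((H' + (2 * ℓ - a) * H (Real.log ‖x‖) : ℝ) : ℂ) := by
    have hre : (inner ℝ x (1 : ℂ) : ℝ) = x.re := by simp [Complex.inner]
    have him : (inner ℝ x Complex.I : ℝ) = x.im := by simp [Complex.inner]
    rw [Dop, wirtingerZ, hL.fderiv, hLv, hLv, hre, him, angularMode, zpow_sub_one₀ hx, hinv,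
      hconj]
    generalize H (Real.log ‖x‖) = h
    generalize x ^ ℓ = u
    push_cast
    have hn : (‖x‖ : ℂ) ≠ 0 := by simpa using hx
    field_simp
    linear_combination (h * u * ℓ * (x.re - x.im * Complex.I)) * Complex.I_sq
  rw [key, norm_mul, norm_mul, norm_zpow, Complex.norm_real, norm_neg, Complex.norm_I,
    Real.norm_eq_abs, one_mul]

theorem tsupport_angularMode_subset {H : ℝ → ℝ} (ℓ : ℤ) {M : ℝ} (h0 : ∀ t ≤ 0, H t = 0)
    (hM : ∀ t, M ≤ t → H t = 0) :
    tsupport (angularMode H ℓ) ⊆ {x : ℂ | 1 ≤ ‖x‖} ∩ Metric.closedBall 0 (Real.exp M) := by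
  refine closure_minimal (fun x hx => ?_)
    ((isClosed_le continuous_const continuous_norm).inter Metric.isClosed_closedBall)
  have hH : H (Real.log ‖x‖) ≠ 0 := fun h => hx (by simp [angularMode, h])
  have h1 : 0 < Real.log ‖x‖ := not_le.1 fun h => hH (h0 _ h)
  have h2 : Real.log ‖x‖ < M := not_le.1 fun h => hH (hM _ h)
  have hx0 : 0 < ‖x‖ := (norm_nonneg x).lt_of_ne' fun h => by simp [h] at h1
  exact ⟨((Real.log_pos_iff hx0.le).1 h1).le,
    by simpa using ((Real.log_lt_iff_lt_exp hx0).1 h2).le⟩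

theorem hasCompactSupport_angularMode {H : ℝ → ℝ} (ℓ : ℤ) {M : ℝ} (h0 : ∀ t ≤ 0, H t = 0)
    (hM : ∀ t, M ≤ t → H t = 0) : HasCompactSupport (angularMode H ℓ) :=
  (isCompact_closedBall (0 : ℂ) (Real.exp M)).of_isClosed_subset (isClosed_tsupport _)
    ((tsupport_angularMode_subset ℓ h0 hM).trans Set.inter_subset_right)

theorem zero_notMem_tsupport_angularMode {H : ℝ → ℝ} (ℓ : ℤ) {M : ℝ} (h0 : ∀ t ≤ 0, H t = 0)
    (hM : ∀ t, M ≤ t → H t = 0) : (0 : ℂ) ∉ tsupport (angularMode H ℓ) := fun h => by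
  have := (tsupport_angularMode_subset ℓ h0 hM h).1
  norm_num at this

theorem contDiff_angularMode {H : ℝ → ℝ} (hH : ContDiff ℝ (⊤ : ℕ∞) H) (ℓ : ℤ) {M : ℝ}
    (h0 : ∀ t ≤ 0, H t = 0) (hM : ∀ t, M ≤ t → H t = 0) :
    ContDiff ℝ (⊤ : ℕ∞) (angularMode H ℓ) := by
  refine contDiff_iff_contDiffAt.2 fun x => ?_
  by_cases hx : x ∈ tsupport (angularMode H ℓ)
  swap
  · exact contDiffAt_const.congr_of_eventuallyEq (notMem_tsupport_iff_eventuallyEq.1 hx)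
  have hx0 : x ≠ 0 := by
    rintro rfl
    exact zero_notMem_tsupport_angularMode ℓ h0 hM hx
  have h₁ : ContDiffAt ℝ (⊤ : ℕ∞) (fun y : ℂ => H (Real.log ‖y‖)) x :=
    hH.contDiffAt.comp x ((contDiffAt_norm ℝ hx0).log (by simpa using hx0))
  have h₂ : ContDiffAt ℝ (⊤ : ℕ∞) (fun y : ℂ => y ^ ℓ) x := by
    have : AnalyticAt ℂ (fun y : ℂ => y ^ ℓ) x := analyticAt_id.zpow hx0
    exact this.contDiffAt.restrict_scalars ℝ
  exact (Complex.ofRealCLM.contDiff.contDiffAt.comp x h₁).mul h₂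

theorem integral_norm_rpow_neg_two_mul_comp_log (F : ℝ → ℝ) {ε : ℝ} (hε : 0 < ε) :
    ∫ x : ℂ, ‖x‖ ^ (-2 : ℝ) * F (ε * Real.log ‖x‖)
      = (2 * volume.real (Metric.ball (0 : ℂ) 1) * ε⁻¹) * ∫ t, F t := by
  have hpolar := integral_fun_norm_addHaar (volume : Measure ℂ)
    (fun r : ℝ => r ^ (-2 : ℝ) * F (ε * Real.log r))
  have hexp := integral_image_eq_integral_abs_deriv_smul (s := Set.univ) MeasurableSet.univ
    (fun t _ => (Real.hasDerivAt_exp t).hasDerivWithinAt) Real.exp_injective.injOn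
    (fun r : ℝ => r ^ (2 - 1) • (r ^ (-2 : ℝ) * F (ε * Real.log r)))
  rw [Set.image_univ, Real.range_exp, setIntegral_univ] at hexp
  rw [hpolar, Complex.finrank_real_complex, hexp]
  have hint : ∀ t : ℝ, |Real.exp t| • (Real.exp t ^ (2 - 1)
      • (Real.exp t ^ (-2 : ℝ) * F (ε * Real.log (Real.exp t)))) = F (ε * t) := fun t => by
    rw [Real.log_exp, abs_of_pos (Real.exp_pos t), ← Real.exp_mul, smul_eq_mul, smul_eq_mul,
      Nat.add_one_sub_one, pow_one, ← mul_assoc, ← mul_assoc, ← Real.exp_add, ← Real.exp_add]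
    ring_nf
    simp
  simp_rw [hint]
  rw [Measure.integral_comp_mul_left, abs_of_pos (inv_pos.2 hε)]
  simp only [nsmul_eq_mul, smul_eq_mul]
  push_cast
  ring

/-- Testing against profiles of the form `ψ (ε t)` and letting `ε → 0` leaves only `k ^ 2`. -/
theorem le_sq_of_forall_integral_le {ψ : ℝ → ℝ} (hψ : ContDiff ℝ 1 ψ)
    (hc : HasCompactSupport ψ) (hpos : 0 < ∫ t, ψ t ^ 2) {C k : ℝ}
    (h : ∀ ε > 0, C * ∫ t, ψ t ^ 2 ≤ ∫ t, (ε * deriv ψ t + k * ψ t) ^ 2) : C ≤ k ^ 2 := by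
  have hd : Continuous (deriv ψ) := hψ.continuous_deriv le_rfl
  have hi₁ : Integrable fun t => deriv ψ t * deriv ψ t :=
    (hd.mul hd).integrable_of_hasCompactSupport hc.deriv.mul_right
  have hi₂ : Integrable fun t => deriv ψ t * ψ t :=
    (hd.mul hψ.continuous).integrable_of_hasCompactSupport hc.deriv.mul_right
  have hi₃ : Integrable fun t => ψ t * ψ t :=
    (hψ.continuous.mul hψ.continuous).integrable_of_hasCompactSupport hc.mul_right
  have hexpand : ∀ ε : ℝ, ∫ t, (ε * deriv ψ t + k * ψ t) ^ 2
      = ε ^ 2 * (∫ t, deriv ψ t * deriv ψ t) + 2 * ε * k * (∫ t, deriv ψ t * ψ t)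
        + k ^ 2 * ∫ t, ψ t ^ 2 := fun ε => by
    have : ∀ t, (ε * deriv ψ t + k * ψ t) ^ 2 = ε ^ 2 * (deriv ψ t * deriv ψ t)
        + 2 * ε * k * (deriv ψ t * ψ t) + k ^ 2 * (ψ t * ψ t) := fun t => by ring
    have hi₁₂ : Integrable fun t => ε ^ 2 * (deriv ψ t * deriv ψ t)
        + 2 * ε * k * (deriv ψ t * ψ t) := (hi₁.const_mul _).add (hi₂.const_mul _)
    simp_rw [this, pow_two (ψ _)]
    rw [integral_add hi₁₂ (hi₃.const_mul _), integral_add (hi₁.const_mul _) (hi₂.const_mul _)]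
    simp only [integral_const_mul]
  simp_rw [hexpand] at h
  set A := ∫ t, deriv ψ t * deriv ψ t
  set B := ∫ t, deriv ψ t * ψ t
  set I := ∫ t, ψ t ^ 2
  have hcont : Continuous fun ε : ℝ => ε ^ 2 * A + 2 * ε * k * B + k ^ 2 * I := by fun_prop
  have hlim : Filter.Tendsto (fun ε : ℝ => ε ^ 2 * A + 2 * ε * k * B + k ^ 2 * I)
      (nhdsWithin 0 (Set.Ioi 0)) (nhds (k ^ 2 * I)) := by
    refine (tendsto_nhdsWithin_of_tendsto_nhds hcont.continuousAt.tendsto).trans ?_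
    simp
  have hle : C * I ≤ k ^ 2 * I :=
    ge_of_tendsto hlim (Filter.eventually_of_mem self_mem_nhdsWithin fun ε hε => h ε hε)
  exact le_of_mul_le_mul_right hle hpos

theorem exists_contDiff_profile : ∃ ψ : ℝ → ℝ, ContDiff ℝ (⊤ : ℕ∞) ψ ∧ HasCompactSupport ψ ∧
    0 < ∫ t, ψ t ^ 2 ∧ (∀ t ≤ 0, ψ t = 0) ∧ ∀ t, 3 ≤ t → ψ t = 0 := by
  let b : ContDiffBump (2 : ℝ) := ⟨1 / 2, 1, by norm_num, by norm_num⟩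
  have hzero : ∀ t, 1 ≤ |t - 2| → b t = 0 := fun t ht => b.zero_of_le_dist ht
  refine ⟨b, b.contDiff, b.hasCompactSupport, ?_, fun t ht => hzero t ?_, fun t ht => hzero t ?_⟩
  · have hcont : Continuous fun t => b t ^ 2 := b.continuous.pow 2
    refine hcont.integral_pos_of_hasCompactSupport_nonneg_nonzero (x := 2) ?_
      (fun t => sq_nonneg _) ?_
    · exact b.hasCompactSupport.comp_left (g := fun y => y ^ 2) (by simp)
    · exact pow_ne_zero 2 (b.pos_of_mem_ball (Metric.mem_ball_self one_pos)).ne'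
  · exact le_abs.2 (Or.inr (by linarith))
  · exact le_abs.2 (Or.inl (by linarith))

/-- The radial profile `ψ (ε t) exp (-(ζ / 2 + ℓ) t)` in the variable `t = log r`. -/
noncomputable def weightedProfile (ψ : ℝ → ℝ) (ε ζ : ℝ) (ℓ : ℤ) (t : ℝ) : ℝ :=
  ψ (ε * t) * Real.exp (-(ζ / 2 + ℓ) * t)

theorem hasDerivAt_weightedProfile {ψ : ℝ → ℝ} (hψ : Differentiable ℝ ψ) (ε ζ : ℝ) (ℓ : ℤ)
    (t : ℝ) :
    HasDerivAt (weightedProfile ψ ε ζ ℓ)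
      ((ε * deriv ψ (ε * t) - (ζ / 2 + ℓ) * ψ (ε * t)) * Real.exp (-(ζ / 2 + ℓ) * t)) t := by
  have h₁ : HasDerivAt (fun s => ψ (ε * s)) (deriv ψ (ε * t) * ε) t := by
    simpa [Function.comp_def] using (hψ (ε * t)).hasDerivAt.comp t ((hasDerivAt_id t).const_mul ε)
  have h₂ : HasDerivAt (fun s => Real.exp (-(ζ / 2 + ℓ) * s))
      (Real.exp (-(ζ / 2 + ℓ) * t) * -(ζ / 2 + ℓ)) t := by
    simpa using ((hasDerivAt_id t).const_mul (-(ζ / 2 + ℓ))).exp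
  exact (h₁.mul h₂).congr_deriv (by ring)

theorem rpow_mul_sq_zpow_mul_abs_exp {r : ℝ} (hr : 0 < r) (ζ u : ℝ) (ℓ : ℤ) :
    r ^ ζ * (r ^ (ℓ - 1) * |u * Real.exp (-(ζ / 2 + ℓ) * Real.log r)|) ^ 2
      = r ^ (-2 : ℝ) * u ^ 2 := by
  rw [mul_pow, sq_abs, mul_pow, ← Real.rpow_intCast, Real.rpow_def_of_pos hr,
    Real.rpow_def_of_pos hr, Real.rpow_def_of_pos hr, ← Real.exp_nat_mul, ← Real.exp_nat_mul,
    mul_left_comm _ (u ^ 2), mul_left_comm _ (u ^ 2), ← Real.exp_add, ← Real.exp_add, mul_comm]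
  congr 2
  push_cast
  ring

section PauliHardy

variable {ψ : ℝ → ℝ} {ε : ℝ}

theorem integral_norm_rpow_mul_angularMode (ψ : ℝ → ℝ) (hε : 0 < ε) (ζ : ℝ) (ℓ : ℤ) :
    ∫ x : ℂ, ‖x‖ ^ (ζ - 2) * ‖angularMode (weightedProfile ψ ε ζ ℓ) ℓ x‖ ^ 2
      = (2 * volume.real (Metric.ball (0 : ℂ) 1) * ε⁻¹) * ∫ t, ψ t ^ 2 := by
  rw [← integral_norm_rpow_neg_two_mul_comp_log _ hε]
  refine integral_congr_ae ?_
  filter_upwards [Measure.ae_ne volume (0 : ℂ)] with x hx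
  have hr : 0 < ‖x‖ := norm_pos_iff.2 hx
  rw [← rpow_mul_sq_zpow_mul_abs_exp hr ζ _ ℓ, angularMode, norm_mul, norm_zpow,
    Complex.norm_real, Real.norm_eq_abs, weightedProfile, zpow_sub_one₀ hr.ne',
    Real.rpow_sub hr, Real.rpow_ofNat]
  field_simp

theorem integral_norm_rpow_mul_DopStar_angularMode (hψ : Differentiable ℝ ψ) (hε : 0 < ε)
    (a ζ : ℝ) (ℓ : ℤ) :
    ∫ x : ℂ, ‖x‖ ^ ζ * ‖DopStar a (angularMode (weightedProfile ψ ε ζ ℓ) ℓ) x‖ ^ 2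
      = (2 * volume.real (Metric.ball (0 : ℂ) 1) * ε⁻¹)
        * ∫ t, (ε * deriv ψ t + (a - ζ / 2 - ℓ) * ψ t) ^ 2 := by
  rw [← integral_norm_rpow_neg_two_mul_comp_log _ hε]
  refine integral_congr_ae ?_
  filter_upwards [Measure.ae_ne volume (0 : ℂ)] with x hx
  rw [← rpow_mul_sq_zpow_mul_abs_exp (norm_pos_iff.2 hx) ζ _ ℓ,
    norm_DopStar_angularMode a ℓ hx (hasDerivAt_weightedProfile hψ ε ζ ℓ _), weightedProfile]
  ring_nf

theorem integral_norm_rpow_mul_Dop_angularMode (hψ : Differentiable ℝ ψ) (hε : 0 < ε)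
    (a ζ : ℝ) (ℓ : ℤ) :
    ∫ x : ℂ, ‖x‖ ^ ζ * ‖Dop a (angularMode (weightedProfile ψ ε ζ ℓ) ℓ) x‖ ^ 2
      = (2 * volume.real (Metric.ball (0 : ℂ) 1) * ε⁻¹)
        * ∫ t, (ε * deriv ψ t + -(a + ζ / 2 - ℓ) * ψ t) ^ 2 := by
  rw [← integral_norm_rpow_neg_two_mul_comp_log _ hε]
  refine integral_congr_ae ?_
  filter_upwards [Measure.ae_ne volume (0 : ℂ)] with x hx
  rw [← rpow_mul_sq_zpow_mul_abs_exp (norm_pos_iff.2 hx) ζ _ ℓ,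
    norm_Dop_angularMode a ℓ hx (hasDerivAt_weightedProfile hψ ε ζ ℓ _), weightedProfile]
  ring_nf

end PauliHardy

theorem stmt3 (a ζ : ℝ) (ha : a ∈ Set.Icc (0 : ℝ) (1/2)) (C : ℝ)
    (hC : ∀ φ χ : ℂ → ℂ,
      ContDiff ℝ (⊤ : ℕ∞) φ → HasCompactSupport φ → (0 : ℂ) ∉ tsupport φ →
      ContDiff ℝ (⊤ : ℕ∞) χ → HasCompactSupport χ → (0 : ℂ) ∉ tsupport χ →
      ∫ x : ℂ, ‖x‖ ^ ζ * (‖Dop a χ x‖^2 + ‖DopStar a φ x‖^2) ≥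
        C * ∫ x : ℂ, ‖x‖ ^ (ζ - 2) * (‖φ x‖^2 + ‖χ x‖^2)) :
    C ≤ min (⨅ ℓ : ℤ, (a + ζ/2 - (ℓ : ℝ))^2) (⨅ ℓ : ℤ, (a - ζ/2 - (ℓ : ℝ))^2) := by
  obtain ⟨ψ, hψ, hc, hpos, h0, h3⟩ := exists_contDiff_profile
  have hψ1 : ContDiff ℝ 1 ψ := hψ.of_le (by exact_mod_cast le_top)
  have hdiff : Differentiable ℝ ψ := hψ1.differentiable one_ne_zero
  have hH : ∀ ε (ℓ : ℤ), ContDiff ℝ (⊤ : ℕ∞) (weightedProfile ψ ε ζ ℓ) := fun ε ℓ =>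
    (hψ.comp (contDiff_const.mul contDiff_id)).mul (contDiff_const.mul contDiff_id).exp
  have hH0 : ∀ ε > 0, ∀ ℓ : ℤ, ∀ t ≤ 0, weightedProfile ψ ε ζ ℓ t = 0 := fun ε hε ℓ t ht => by
    rw [weightedProfile, h0 _ (mul_nonpos_of_nonneg_of_nonpos hε.le ht), zero_mul]
  have hH3 : ∀ ε > 0, ∀ ℓ : ℤ, ∀ t, 3 / ε ≤ t → weightedProfile ψ ε ζ ℓ t = 0 :=
    fun ε hε ℓ t ht => by
      rw [weightedProfile, h3 _ ((div_le_iff₀' hε).1 ht), zero_mul]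
  have hball : 0 < volume.real (Metric.ball (0 : ℂ) 1) :=
    ENNReal.toReal_pos (Metric.measure_ball_pos _ _ one_pos).ne' measure_ball_lt_top.ne
  have hzero : tsupport (fun _ : ℂ => (0 : ℂ)) = ∅ := tsupport_eq_empty_iff.2 rfl
  have hDop : ∀ x, Dop a (fun _ => 0) x = 0 := fun x => by simp [Dop, wirtingerZ]
  have hDopStar : ∀ x, DopStar a (fun _ => 0) x = 0 := fun x => by simp [DopStar, wirtingerZbar]
  refine le_min (le_ciInf fun ℓ => ?_) (le_ciInf fun ℓ => ?_)
  · rw [← neg_sq]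
    refine le_sq_of_forall_integral_le hψ1 hc hpos fun ε hε => ?_
    have h := hC (fun _ => 0) (angularMode (weightedProfile ψ ε ζ ℓ) ℓ) contDiff_const
      (by simp [HasCompactSupport, hzero]) (by simp [hzero])
      (contDiff_angularMode (hH ε ℓ) ℓ (hH0 ε hε ℓ) (hH3 ε hε ℓ))
      (hasCompactSupport_angularMode ℓ (hH0 ε hε ℓ) (hH3 ε hε ℓ))
      (zero_notMem_tsupport_angularMode ℓ (hH0 ε hε ℓ) (hH3 ε hε ℓ))
    simp only [hDopStar, norm_zero, ne_eq, OfNat.ofNat_ne_zero, not_false_eq_true, zero_pow,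
      add_zero, zero_add] at h
    rw [integral_norm_rpow_mul_angularMode ψ hε, integral_norm_rpow_mul_Dop_angularMode hdiff hε,
      mul_left_comm] at h
    exact le_of_mul_le_mul_left h (by positivity)
  · refine le_sq_of_forall_integral_le hψ1 hc hpos fun ε hε => ?_
    have h := hC (angularMode (weightedProfile ψ ε ζ ℓ) ℓ) (fun _ => 0)
      (contDiff_angularMode (hH ε ℓ) ℓ (hH0 ε hε ℓ) (hH3 ε hε ℓ))
      (hasCompactSupport_angularMode ℓ (hH0 ε hε ℓ) (hH3 ε hε ℓ))
      (zero_notMem_tsupport_angularMode ℓ (hH0 ε hε ℓ) (hH3 ε hε ℓ)) contDiff_const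
      (by simp [HasCompactSupport, hzero]) (by simp [hzero])
    simp only [hDop, norm_zero, ne_eq, OfNat.ofNat_ne_zero, not_false_eq_true, zero_pow,
      add_zero, zero_add] at h
    rw [integral_norm_rpow_mul_angularMode ψ hε,
      integral_norm_rpow_mul_DopStar_angularMode hdiff hε, mul_left_comm] at h
    exact le_of_mul_le_mul_left h (by positivity)
end

section
/- Let ν ∈ (0,1/2], a ∈ [0, 1/2 − ν], c(a) = 1/2 − a, and μ = (c(a) − √(c(a)² − ν²))/ν. Then for every φ ∈ C_c^∞((0,∞),ℂ), ∫₀^∞ |φ'(ρ)|²/(ν+ρ) · ρ^{2−2a} dρ + μ² ∫₀^∞ |φ(ρ)|² ρ^{1−2a} dρ ≥ ν ∫₀^∞ |φ(ρ)|² ρ^{−2a} dρ. -/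
open MeasureTheory

/-- A function continuous on `(0, ∞)` that vanishes outside a compact subset of `(0, ∞)` is
integrable on `(0, ∞)`. -/
lemma integrableOn_Ioi_of_continuousOn_of_isCompact {K : Set ℝ} (hK : IsCompact K)
    (hK0 : K ⊆ Set.Ioi 0) {f : ℝ → ℝ} (hf : ContinuousOn f (Set.Ioi 0))
    (h0 : ∀ x, x ∉ K → f x = 0) : IntegrableOn f (Set.Ioi 0) :=
  ((hf.mono hK0).integrableOn_compact hK).of_forall_sdiff_eq_zero measurableSet_Ioi
    fun x hx => h0 x hx.2

/-- Completing the square in the weighted energy density. -/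
lemma weighted_energy_density_nonneg {ν μ a ρ : ℝ} (hν : 0 < ν) (hρ : 0 < ρ)
    (hμ : ν * μ ^ 2 - (1 - 2 * a) * μ + ν = 0) (z w : ℂ) :
    0 ≤ ‖w‖ ^ 2 / (ν + ρ) * ρ ^ (2 - 2 * a) + μ ^ 2 * (‖z‖ ^ 2 * ρ ^ (1 - 2 * a))
      + (2 * inner ℝ z w * (μ * ρ ^ (1 - 2 * a))
        + ‖z‖ ^ 2 * (μ * ((1 - 2 * a) * ρ ^ (-2 * a))))
      - ν * (‖z‖ ^ 2 * ρ ^ (-2 * a)) := by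
  have e1 : ρ ^ (1 - 2 * a) = ρ ^ (-2 * a) * ρ := by
    rw [← Real.rpow_add_one hρ.ne']; ring_nf
  have e2 : ρ ^ (2 - 2 * a) = ρ ^ (-2 * a) * ρ ^ 2 := by
    rw [← Real.rpow_natCast, ← Real.rpow_add hρ]; congr 1; push_cast; ring
  have hp : 0 < ρ ^ (-2 * a) := Real.rpow_pos_of_pos hρ _
  have hs : 0 < ν + ρ := by positivity
  have hsq := norm_add_sq_real ((μ * (ν + ρ)) • z) (ρ • w)
  rw [norm_smul, norm_smul, real_inner_smul_left, real_inner_smul_right, mul_pow, mul_pow,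
    Real.norm_eq_abs, Real.norm_eq_abs, sq_abs, sq_abs] at hsq
  have key : 0 ≤ ρ ^ (-2 * a) / (ν + ρ) * ‖(μ * (ν + ρ)) • z + ρ • w‖ ^ 2 := by positivity
  rw [hsq] at key
  rw [e1, e2]
  refine key.trans_eq ?_
  field_simp
  linear_combination (‖z‖ ^ 2 * (ν + ρ)) * hμ

theorem stmt4 (ν a : ℝ) (hν : ν ∈ Set.Ioc (0 : ℝ) (1/2)) (ha : a ∈ Set.Icc (0 : ℝ) (1/2 - ν))
    (μ : ℝ) (hμ : μ = ((1/2 - a) - Real.sqrt ((1/2 - a)^2 - ν^2)) / ν)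
    (φ : ℝ → ℂ) (hφs : ContDiff ℝ (⊤ : ℕ∞) φ) (hφc : HasCompactSupport φ)
    (hφ0 : tsupport φ ⊆ Set.Ioi (0 : ℝ)) :
    (∫ ρ in Set.Ioi (0 : ℝ), ‖deriv φ ρ‖^2 / (ν + ρ) * ρ ^ (2 - 2*a))
      + μ^2 * ∫ ρ in Set.Ioi (0 : ℝ), ‖φ ρ‖^2 * ρ ^ (1 - 2*a)
      ≥ ν * ∫ ρ in Set.Ioi (0 : ℝ), ‖φ ρ‖^2 * ρ ^ (-2*a) := by
  obtain ⟨hν0, -⟩ := hν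
  have hroot : ν * μ ^ 2 - (1 - 2 * a) * μ + ν = 0 := by
    have hnn : 0 ≤ (1/2 - a)^2 - ν^2 := by nlinarith [ha.2]
    have hsq := Real.sq_sqrt hnn
    generalize √((1/2 - a)^2 - ν^2) = r at hμ hsq
    rw [hμ]
    field_simp
    linear_combination 4 * hsq
  have hφ_cont : Continuous φ := hφs.continuous
  have hφ'_cont : Continuous (deriv φ) := hφs.continuous_deriv (by simp)
  have hφ_zero : ∀ x, x ∉ tsupport φ → φ x = 0 := fun x hx => image_eq_zero_of_notMem_tsupport hx
  have hφ'_zero : ∀ x, x ∉ tsupport φ → deriv φ x = 0 := fun x hx =>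
    Function.notMem_support.mp fun h => hx (support_deriv_subset h)
  have hpow : ∀ s : ℝ, ContinuousOn (fun ρ : ℝ => ρ ^ s) (Set.Ioi 0) := fun s ρ hρ =>
    (Real.continuousAt_rpow_const ρ s (Or.inl (ne_of_gt hρ))).continuousWithinAt
  have hinv : ContinuousOn (fun ρ : ℝ => ‖deriv φ ρ‖ ^ 2 / (ν + ρ)) (Set.Ioi 0) :=
    ContinuousOn.div (by fun_prop) (by fun_prop) fun ρ hρ => (add_pos hν0 hρ).ne'
  have hint := fun f => integrableOn_Ioi_of_continuousOn_of_isCompact (f := f) hφc hφ0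
  have i1 := hint (fun ρ => ‖deriv φ ρ‖^2 / (ν + ρ) * ρ ^ (2 - 2*a)) (hinv.mul (hpow _))
    fun x hx => by simp [hφ'_zero x hx]
  have i2 := hint (fun ρ => ‖φ ρ‖^2 * ρ ^ (1 - 2*a))
    ((by fun_prop : ContinuousOn (fun ρ => ‖φ ρ‖^2) _).mul (hpow _))
    fun x hx => by simp [hφ_zero x hx]
  have i3 := hint (fun ρ => ‖φ ρ‖^2 * ρ ^ (-2*a))
    ((by fun_prop : ContinuousOn (fun ρ => ‖φ ρ‖^2) _).mul (hpow _))
    fun x hx => by simp [hφ_zero x hx]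
  have i4 := hint (fun ρ => 2 * inner ℝ (φ ρ) (deriv φ ρ) * (μ * ρ ^ (1 - 2 * a))
      + ‖φ ρ‖ ^ 2 * (μ * ((1 - 2 * a) * ρ ^ (-2 * a))))
    (by
      have h1 := hpow (1 - 2 * a)
      have h2 := hpow (-2 * a)
      have h3 : Continuous fun ρ => inner ℝ (φ ρ) (deriv φ ρ) := hφ_cont.inner hφ'_cont
      fun_prop)
    fun x hx => by simp [hφ_zero x hx]
  have hbdry : ∫ ρ in Set.Ioi (0 : ℝ), (2 * inner ℝ (φ ρ) (deriv φ ρ) * (μ * ρ ^ (1 - 2 * a))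
      + ‖φ ρ‖ ^ 2 * (μ * ((1 - 2 * a) * ρ ^ (-2 * a)))) = 0 := by
    have h0 : φ =ᶠ[nhds 0] 0 :=
      notMem_tsupport_iff_eventuallyEq.mp fun h => lt_irrefl (0 : ℝ) (hφ0 h)
    have hinf : φ =ᶠ[Filter.atTop] 0 :=
      (hasCompactSupport_iff_eventuallyEq.mp hφc).filter_mono
        (by rw [Filter.coclosedCompact_eq_cocompact]; exact atTop_le_cocompact)
    rw [integral_Ioi_of_hasDerivAt_of_tendsto
      (f := fun ρ => ‖φ ρ‖ ^ 2 * (μ * ρ ^ (1 - 2 * a))) (m := 0) _ _ i4 _]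
    · simp [h0.eq_of_nhds]
    · refine ContinuousAt.continuousWithinAt ?_
      refine (continuousAt_const (y := (0 : ℝ))).congr ?_
      filter_upwards [h0] with x hx
      simp [hx]
    · intro x hx
      have hd : HasDerivAt φ (deriv φ x) x :=
        (hφs.differentiable (by simp) x).hasDerivAt
      have hp := Real.hasDerivAt_rpow_const (p := 1 - 2 * a) (Or.inl (ne_of_gt hx))
      rw [show 1 - 2 * a - 1 = -2 * a by ring] at hp
      exact hd.norm_sq.mul (hp.const_mul μ)
    · refine tendsto_const_nhds.congr' ?_
      filter_upwards [hinf] with x hx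
      simp [hx]
  have hnonneg : 0 ≤ ∫ ρ in Set.Ioi (0 : ℝ), (‖deriv φ ρ‖ ^ 2 / (ν + ρ) * ρ ^ (2 - 2 * a)
      + μ ^ 2 * (‖φ ρ‖ ^ 2 * ρ ^ (1 - 2 * a))
      + (2 * inner ℝ (φ ρ) (deriv φ ρ) * (μ * ρ ^ (1 - 2 * a))
        + ‖φ ρ‖ ^ 2 * (μ * ((1 - 2 * a) * ρ ^ (-2 * a))))
      - ν * (‖φ ρ‖ ^ 2 * ρ ^ (-2 * a))) :=
    setIntegral_nonneg measurableSet_Ioi fun ρ hρ =>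
      weighted_energy_density_nonneg hν0 hρ hroot (φ ρ) (deriv φ ρ)
  have i12 := i1.integrable.fun_add (i2.integrable.const_mul (μ ^ 2))
  rw [integral_sub (i12.fun_add i4) (i3.integrable.const_mul ν), integral_add i12 i4, hbdry,
    integral_add i1 (i2.integrable.const_mul _), integral_const_mul, integral_const_mul] at hnonneg
  linarith
end

section
/- Let ν ∈ (0,1/2), a ∈ [0, 1/2 − ν), c(a) = 1/2 − a, μ = (c(a) − √(c(a)² − ν²))/ν, and φ_⋆(ρ) = ρ^{−μν} e^{−μρ} for ρ > 0. Then the integrals ∫₀^∞ |φ_⋆'(ρ)|²/(ν+ρ) · ρ^{2−2a} dρ, ∫₀^∞ |φ_⋆(ρ)|² ρ^{1−2a} dρ and ∫₀^∞ |φ_⋆(ρ)|² ρ^{−2a} dρ are all finite, and ∫₀^∞ |φ_⋆'(ρ)|²/(ν+ρ) · ρ^{2−2a} dρ + μ² ∫₀^∞ |φ_⋆(ρ)|² ρ^{1−2a} dρ = ν ∫₀^∞ |φ_⋆(ρ)|² ρ^{−2a} dρ; i.e., φ_⋆ realizes the equality case of the one-dimensional weighted Hardy inequality. -/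
open MeasureTheory

lemma integrableOn_rpow_sub_one_mul_exp_neg_mul {s r : ℝ} (hs : 0 < s) (hr : 0 < r) :
    IntegrableOn (fun ρ : ℝ => ρ ^ (s - 1) * Real.exp (-(r * ρ))) (Set.Ioi 0) :=
  .of_integral_ne_zero (by
    rw [Real.integral_rpow_mul_exp_neg_mul_Ioi hs hr]
    have := Real.Gamma_pos_of_pos hs
    positivity)

lemma integral_rpow_mul_exp_neg_mul_eq_div_mul {s r : ℝ} (hs : 0 < s) (hr : 0 < r) :
    ∫ ρ in Set.Ioi (0 : ℝ), ρ ^ (s + 1 - 1) * Real.exp (-(r * ρ)) =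
      s / r * ∫ ρ in Set.Ioi (0 : ℝ), ρ ^ (s - 1) * Real.exp (-(r * ρ)) := by
  rw [Real.integral_rpow_mul_exp_neg_mul_Ioi hs hr,
    Real.integral_rpow_mul_exp_neg_mul_Ioi (by positivity) hr, Real.Gamma_add_one hs.ne',
    Real.rpow_add_one (by positivity)]
  ring

lemma hasDerivAt_rpow_mul_exp {p q ρ : ℝ} (hρ : 0 < ρ) :
    HasDerivAt (fun x : ℝ => x ^ p * Real.exp (q * x))
      ((p / ρ + q) * (ρ ^ p * Real.exp (q * ρ))) ρ := by
  have h₁ := Real.hasDerivAt_rpow_const (x := ρ) (p := p) (Or.inl hρ.ne')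
  have h₂ := ((hasDerivAt_id ρ).const_mul q).exp
  convert! h₁.mul h₂ using 1
  simp only [id, Real.rpow_sub_one hρ.ne']
  ring

lemma sq_rpow_mul_exp_mul_rpow {p q b ρ : ℝ} (hρ : 0 < ρ) :
    (ρ ^ p * Real.exp (q * ρ)) ^ 2 * ρ ^ b = ρ ^ (2 * p + b) * Real.exp (2 * q * ρ) := by
  rw [mul_pow, ← Real.rpow_mul_natCast hρ.le, ← Real.exp_nat_mul, Real.rpow_add hρ]
  push_cast
  ring_nf

theorem stmt5 (ν a : ℝ) (hν : ν ∈ Set.Ioo (0 : ℝ) (1/2)) (ha : a ∈ Set.Ico (0 : ℝ) (1/2 - ν))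
    (μ : ℝ) (hμ : μ = ((1/2 - a) - Real.sqrt ((1/2 - a)^2 - ν^2)) / ν)
    (φ : ℝ → ℝ) (hφ : ∀ ρ > (0 : ℝ), φ ρ = ρ ^ (-(μ*ν)) * Real.exp (-μ*ρ)) :
    IntegrableOn (fun ρ : ℝ => (deriv φ ρ)^2 / (ν + ρ) * ρ ^ (2 - 2*a)) (Set.Ioi 0) ∧
    IntegrableOn (fun ρ : ℝ => (φ ρ)^2 * ρ ^ (1 - 2*a)) (Set.Ioi 0) ∧
    IntegrableOn (fun ρ : ℝ => (φ ρ)^2 * ρ ^ (-2*a)) (Set.Ioi 0) ∧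
    (∫ ρ in Set.Ioi (0 : ℝ), (deriv φ ρ)^2 / (ν + ρ) * ρ ^ (2 - 2*a))
      + μ^2 * (∫ ρ in Set.Ioi (0 : ℝ), (φ ρ)^2 * ρ ^ (1 - 2*a))
      = ν * ∫ ρ in Set.Ioi (0 : ℝ), (φ ρ)^2 * ρ ^ (-2*a) := by
  obtain ⟨hν₀, -⟩ := hν
  obtain ⟨-, haν⟩ := ha
  have hD : 0 < (1/2 - a)^2 - ν^2 := by nlinarith
  set d := Real.sqrt ((1/2 - a)^2 - ν^2)
  have hd₀ : 0 < d := Real.sqrt_pos.2 hD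
  have hd₂ : d ^ 2 = (1/2 - a)^2 - ν^2 := Real.sq_sqrt hD.le
  have hμν : μ * ν = 1/2 - a - d := by rw [hμ]; field_simp
  have hdc : d < 1/2 - a := by nlinarith
  have hμ₀ : 0 < μ := by rw [hμ]; exact div_pos (by linarith) hν₀
  have hquad : ν * μ ^ 2 - 2 * (1/2 - a) * μ + ν = 0 := by
    refine (mul_eq_zero.1 (?_ : ν * _ = 0)).resolve_left hν₀.ne'
    linear_combination (μ * ν - (1/2 - a) - d) * hμν + hd₂
  have hs : 0 < 2 * d := by positivity
  have hr : 0 < 2 * μ := by positivity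
  have hφ₀ : Set.EqOn (fun ρ : ℝ => (φ ρ)^2 * ρ ^ (-2*a))
      (fun ρ => ρ ^ (2 * d - 1) * Real.exp (-(2 * μ * ρ))) (Set.Ioi 0) := by
    intro ρ hρ
    simp only [hφ ρ hρ, sq_rpow_mul_exp_mul_rpow (Set.mem_Ioi.1 hρ), hμν]
    ring_nf
  have hφ₁ : Set.EqOn (fun ρ : ℝ => (φ ρ)^2 * ρ ^ (1 - 2*a))
      (fun ρ => ρ ^ (2 * d + 1 - 1) * Real.exp (-(2 * μ * ρ))) (Set.Ioi 0) := by
    intro ρ hρ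
    simp only [hφ ρ hρ, sq_rpow_mul_exp_mul_rpow (Set.mem_Ioi.1 hρ), hμν]
    ring_nf
  have hφ' : Set.EqOn (fun ρ : ℝ => (deriv φ ρ)^2 / (ν + ρ) * ρ ^ (2 - 2*a))
      (fun ρ => μ ^ 2 * ν * ((φ ρ)^2 * ρ ^ (-2*a)) + μ ^ 2 * ((φ ρ)^2 * ρ ^ (1 - 2*a)))
      (Set.Ioi 0) := by
    intro ρ hρ
    have hρ₀ : 0 < ρ := hρ
    have hderiv : deriv φ ρ = (-(μ * ν) / ρ + -μ) * φ ρ := by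
      rw [hφ ρ hρ]
      refine ((hasDerivAt_rpow_mul_exp hρ₀).congr_of_eventuallyEq ?_).deriv
      filter_upwards [Ioi_mem_nhds hρ₀] with x hx using hφ x hx
    have h₁ : ρ ^ (1 - 2*a) = ρ * ρ ^ (-2*a) := by
      rw [show 1 - 2*a = 1 + -2*a by ring, Real.rpow_add hρ₀, Real.rpow_one]
    have h₂ : ρ ^ (2 - 2*a) = ρ ^ 2 * ρ ^ (-2*a) := by
      rw [show 2 - 2*a = 2 + -2*a by ring, Real.rpow_add hρ₀, Real.rpow_two]
    have hνρ : ν + ρ ≠ 0 := by positivity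
    simp only [hderiv, h₁, h₂]
    field_simp
    ring
  have hi₀ := (integrableOn_congr_fun hφ₀ measurableSet_Ioi).2
    (integrableOn_rpow_sub_one_mul_exp_neg_mul hs hr)
  have hi₁ := (integrableOn_congr_fun hφ₁ measurableSet_Ioi).2
    (integrableOn_rpow_sub_one_mul_exp_neg_mul (by positivity) hr)
  have hI : ∫ ρ in Set.Ioi (0 : ℝ), (φ ρ)^2 * ρ ^ (1 - 2*a) =
      2 * d / (2 * μ) * ∫ ρ in Set.Ioi (0 : ℝ), (φ ρ)^2 * ρ ^ (-2*a) := by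
    rw [setIntegral_congr_fun measurableSet_Ioi hφ₀, setIntegral_congr_fun measurableSet_Ioi hφ₁]
    exact integral_rpow_mul_exp_neg_mul_eq_div_mul hs hr
  refine ⟨(integrableOn_congr_fun hφ' measurableSet_Ioi).2
    ((hi₀.const_mul _).add (hi₁.const_mul _)), hi₁, hi₀, ?_⟩
  rw [setIntegral_congr_fun measurableSet_Ioi hφ',
    integral_add (hi₀.const_mul _) (hi₁.const_mul _), integral_const_mul, integral_const_mul, hI]
  generalize ∫ ρ in Set.Ioi (0 : ℝ), (φ ρ)^2 * ρ ^ (-2*a) = I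
  field_simp
  linear_combination (-I) * hquad + 2 * μ * I * hμν
end

section
/- Let ν ∈ (0,1/2], a ∈ [0, 1/2 − ν], c(a) = 1/2 − a, and μ = (c(a) − √(c(a)² − ν²))/ν. For every μ' ∈ [0, μ) there exists φ ∈ C_c^∞((0,∞),ℂ) such that ∫₀^∞ |φ'(ρ)|²/(ν+ρ) · ρ^{2−2a} dρ + (μ')² ∫₀^∞ |φ(ρ)|² ρ^{1−2a} dρ < ν ∫₀^∞ |φ(ρ)|² ρ^{−2a} dρ; i.e., μ is the smallest nonnegative constant for which the one-dimensional weighted Hardy inequality holds for all test functions. -/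
open MeasureTheory

/-- A product with a continuous function compactly supported in `(0, ∞)` is integrable there. -/
lemma integrableOn_Ioi_mul_of_hasCompactSupport {u f : ℝ → ℝ}
    (hu : ContinuousOn u (Set.Ioi 0)) (hf : Continuous f) (hc : HasCompactSupport f)
    (hs : tsupport f ⊆ Set.Ioi 0) : IntegrableOn (fun x => u x * f x) (Set.Ioi 0) := by
  have hcont : Continuous (fun x => u x * f x) :=
    (hu.mul hf.continuousOn).continuous_of_tsupport_subset isOpen_Ioi
      (tsupport_mul_subset_right.trans hs)
  exact (hcont.integrable_of_hasCompactSupport hc.mul_left).integrableOn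

/-- Completing the square in the weighted Hardy functional with the first-order operator
`ψ ↦ ψ' + κ (ν + x) / x * ψ`. -/
lemma integral_sq_add_eq {ν a κ : ℝ} (hν : 0 < ν) {ψ : ℝ → ℝ} (hψ : ContDiff ℝ 1 ψ)
    (hc : HasCompactSupport ψ) (hs : tsupport ψ ⊆ Set.Ioi 0) :
    ∫ x in Set.Ioi (0 : ℝ), (deriv ψ x + κ * (ν + x) / x * ψ x) ^ 2 / (ν + x) * x ^ (2 - 2 * a) =
      (∫ x in Set.Ioi (0 : ℝ), deriv ψ x ^ 2 / (ν + x) * x ^ (2 - 2 * a))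
        + κ ^ 2 * (∫ x in Set.Ioi (0 : ℝ), ψ x ^ 2 * x ^ (1 - 2 * a))
        - (κ * (1 - 2 * a) - κ ^ 2 * ν) * ∫ x in Set.Ioi (0 : ℝ), ψ x ^ 2 * x ^ (-2 * a) := by
  have hψ' : Continuous (deriv ψ) := hψ.continuous_deriv le_rfl
  have hrpow : ∀ p : ℝ, ContinuousOn (fun x : ℝ => x ^ p) (Set.Ioi 0) := fun p =>
    continuousOn_id.rpow_const fun x hx => Or.inl (ne_of_gt hx)
  have hdiff : Differentiable ℝ ψ := hψ.differentiable one_ne_zero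
  have hs' : tsupport (deriv ψ) ⊆ Set.Ioi 0 :=
    (closure_minimal support_deriv_subset (isClosed_tsupport ψ)).trans hs
  have i₁ : IntegrableOn (fun x => deriv ψ x ^ 2 / (ν + x) * x ^ (2 - 2 * a)) (Set.Ioi 0) := by
    have hu : ContinuousOn (fun x : ℝ => deriv ψ x / (ν + x) * x ^ (2 - 2 * a)) (Set.Ioi 0) := by
      refine (hψ'.continuousOn.div (by fun_prop) fun x hx => ?_).mul (hrpow _)
      have : (0 : ℝ) < x := hx
      positivity
    refine (integrableOn_Ioi_mul_of_hasCompactSupport hu hψ' hc.deriv hs').congr_fun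
      (fun x _ => ?_) measurableSet_Ioi
    ring
  have hsq : ∀ p : ℝ, IntegrableOn (fun x => ψ x ^ 2 * x ^ p) (Set.Ioi 0) := fun p => by
    refine (integrableOn_Ioi_mul_of_hasCompactSupport
      (hψ.continuous.continuousOn.mul (hrpow p)) hψ.continuous hc hs).congr_fun
      (fun x _ => ?_) measurableSet_Ioi
    simp only [Pi.mul_apply]
    ring
  have i₂ : IntegrableOn (fun x => (1 - 2 * a) * x ^ (1 - 2 * a - 1) * ψ x ^ 2
      + x ^ (1 - 2 * a) * (2 * ψ x * deriv ψ x)) (Set.Ioi 0) := by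
    have hu : ContinuousOn (fun x : ℝ => (1 - 2 * a) * x ^ (1 - 2 * a - 1) * ψ x
        + x ^ (1 - 2 * a) * (2 * deriv ψ x)) (Set.Ioi 0) :=
      ((continuousOn_const.mul (hrpow _)).mul hψ.continuous.continuousOn).add
        ((hrpow _).mul (continuousOn_const.mul hψ'.continuousOn))
    refine (integrableOn_Ioi_mul_of_hasCompactSupport hu hψ.continuous hc hs).congr_fun
      (fun x _ => ?_) measurableSet_Ioi
    ring
  have hzero : ψ =ᶠ[nhds 0] 0 := notMem_tsupport_iff_eventuallyEq.1 fun h => lt_irrefl (0 : ℝ) (hs h)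
  have hparts : ∫ x in Set.Ioi (0 : ℝ), ((1 - 2 * a) * x ^ (1 - 2 * a - 1) * ψ x ^ 2
      + x ^ (1 - 2 * a) * (2 * ψ x * deriv ψ x)) = 0 := by
    have := integral_Ioi_of_hasDerivAt_of_tendsto (f := fun x => x ^ (1 - 2 * a) * ψ x ^ 2)
      (m := 0) (a := 0) ?_ (fun x hx => ?_) i₂ ?_
    · simpa [hzero.self_of_nhds] using this
    · refine ContinuousAt.continuousWithinAt
        (ContinuousAt.congr (f := fun _ => (0 : ℝ)) continuousAt_const ?_)
      filter_upwards [hzero] with x hx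
      simp [hx]
    · have h := (Real.hasDerivAt_rpow_const (p := 1 - 2 * a) (Or.inl (ne_of_gt hx))).mul
        ((hdiff x).hasDerivAt.pow 2)
      refine h.congr_deriv ?_
      simp
    · refine tendsto_const_nhds.congr' ?_
      filter_upwards [(hasCompactSupport_iff_eventuallyEq.1 hc).filter_mono
        (Filter.coclosedCompact_eq_cocompact (X := ℝ) ▸ atTop_le_cocompact)] with x hx
      simp [hx]
  have key : ∀ x ∈ Set.Ioi (0 : ℝ),
      (deriv ψ x + κ * (ν + x) / x * ψ x) ^ 2 / (ν + x) * x ^ (2 - 2 * a) =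
      ((deriv ψ x ^ 2 / (ν + x) * x ^ (2 - 2 * a) + κ ^ 2 * (ψ x ^ 2 * x ^ (1 - 2 * a)))
        - (κ * (1 - 2 * a) - κ ^ 2 * ν) * (ψ x ^ 2 * x ^ (-2 * a)))
      + κ * ((1 - 2 * a) * x ^ (1 - 2 * a - 1) * ψ x ^ 2
      + x ^ (1 - 2 * a) * (2 * ψ x * deriv ψ x)) := by
    intro x hx
    have hx : 0 < x := hx
    have e₁ : x ^ (2 - 2 * a) = x ^ (-2 * a) * x ^ 2 := by
      rw [← Real.rpow_natCast, ← Real.rpow_add hx]; congr 1; push_cast; ring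
    have e₂ : x ^ (1 - 2 * a) = x ^ (-2 * a) * x := by
      nth_rewrite 3 [← Real.rpow_one x]
      rw [← Real.rpow_add hx]; congr 1; ring
    have e₃ : x ^ (1 - 2 * a - 1) = x ^ (-2 * a) := by congr 1; ring
    have : ν + x ≠ 0 := by positivity
    rw [e₁, e₂, e₃]
    field_simp
    ring
  rw [setIntegral_congr_fun measurableSet_Ioi key, integral_add ?_ (i₂.const_mul κ),
    integral_sub ?_ ((hsq _).const_mul _), integral_add i₁ ((hsq _).const_mul _),
    integral_const_mul, integral_const_mul, integral_const_mul, hparts]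
  · ring
  · exact i₁.add ((hsq _).const_mul _)
  · exact (i₁.add ((hsq _).const_mul _)).sub ((hsq _).const_mul _)

/-- The function `x ↦ x ^ (-s) * exp (-κ x)` on `(0, ∞)`, cut off logarithmically by `η`. -/
noncomputable def logCutoff (η : ℝ → ℝ) (t s κ : ℝ) : ℝ → ℝ :=
  (Set.Ioi 0).indicator fun x => η (t * Real.log x) * (x ^ (-s) * Real.exp (-κ * x))

section logCutoff

variable {η : ℝ → ℝ} {t s κ : ℝ}

lemma tsupport_logCutoff_subset (hη0 : ∀ y, 2 ≤ |y| → η y = 0) (ht : 0 < t) :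
    tsupport (logCutoff η t s κ) ⊆ Set.Icc (Real.exp (-2 / t)) (Real.exp (2 / t)) := by
  refine closure_minimal (fun x hx => ?_) isClosed_Icc
  by_cases h0 : x ∈ Set.Ioi (0 : ℝ)
  · have h0' : 0 < x := h0
    rw [Function.mem_support, logCutoff, Set.indicator_of_mem h0] at hx
    have hlt : |t * Real.log x| < 2 := by
      by_contra! h
      exact hx (by rw [hη0 _ h, zero_mul])
    obtain ⟨h₁, h₂⟩ := abs_lt.1 hlt
    rw [← Real.exp_log h0', Set.mem_Icc, Real.exp_le_exp, Real.exp_le_exp, div_le_iff₀ ht,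
      le_div_iff₀ ht]
    constructor <;> linarith
  · exact absurd (Set.indicator_of_notMem h0 _) hx

lemma logCutoff_eventuallyEq {x : ℝ} (hx : 0 < x) : logCutoff η t s κ =ᶠ[nhds x]
    fun x => η (t * Real.log x) * (x ^ (-s) * Real.exp (-κ * x)) := by
  filter_upwards [Ioi_mem_nhds hx] with y hy
  exact Set.indicator_of_mem (s := Set.Ioi (0 : ℝ)) hy _

lemma contDiff_logCutoff (hη : ContDiff ℝ (⊤ : ℕ∞) η) (hη0 : ∀ y, 2 ≤ |y| → η y = 0)
    (ht : 0 < t) : ContDiff ℝ (⊤ : ℕ∞) (logCutoff η t s κ) := by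
  refine contDiff_iff_contDiffAt.2 fun x => ?_
  rcases lt_or_ge 0 x with hx | hx
  · refine ContDiffAt.congr_of_eventuallyEq ?_ (logCutoff_eventuallyEq hx)
    have h₁ : ContDiffAt ℝ (⊤ : ℕ∞) (fun x => η (t * Real.log x)) x :=
      hη.contDiffAt.comp x (contDiffAt_const.mul (Real.contDiffAt_log.2 hx.ne'))
    have h₂ : ContDiffAt ℝ (⊤ : ℕ∞) (fun x : ℝ => x ^ (-s)) x :=
      contDiffAt_id.rpow_const_of_ne hx.ne'
    exact h₁.mul (h₂.mul (by fun_prop))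
  · refine ContDiffAt.congr_of_eventuallyEq (f := fun _ => (0 : ℝ)) contDiffAt_const ?_
    refine notMem_tsupport_iff_eventuallyEq.1 fun h => ?_
    exact absurd ((Real.exp_pos _).trans_le (tsupport_logCutoff_subset hη0 ht h).1) hx.not_gt

lemma deriv_logCutoff_add (hη : ContDiff ℝ (⊤ : ℕ∞) η) {ν x : ℝ} (hx : 0 < x) :
    deriv (logCutoff η t (κ * ν) κ) x + κ * (ν + x) / x * logCutoff η t (κ * ν) κ x =
      deriv η (t * Real.log x) * (t / x) * (x ^ (-(κ * ν)) * Real.exp (-κ * x)) := by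
  have h₁ : HasDerivAt (fun x => η (t * Real.log x)) (deriv η (t * Real.log x) * (t * x⁻¹)) x :=
    ((hη.differentiable (by simp)) _).hasDerivAt.comp x
      ((Real.hasDerivAt_log hx.ne').const_mul t)
  have h₂ := Real.hasDerivAt_rpow_const (x := x) (p := -(κ * ν)) (Or.inl hx.ne')
  have h₃ : HasDerivAt (fun x => Real.exp (-κ * x)) (Real.exp (-κ * x) * (-κ * 1)) x :=
    ((hasDerivAt_id x).const_mul (-κ)).exp
  have h := h₁.mul (h₂.mul h₃)
  have hd := (h.congr_of_eventuallyEq (logCutoff_eventuallyEq (η := η) (t := t) (s := κ * ν)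
    (κ := κ) hx)).deriv
  rw [hd, (logCutoff_eventuallyEq hx).self_of_nhds, Real.rpow_sub_one hx.ne']
  simp only [Pi.mul_apply]
  field_simp
  ring

end logCutoff

/-- Logarithmic cutoffs of `x ^ (-κν) * exp (-κ x)` are almost annihilated by
`ψ ↦ ψ' + κ (ν + x) / x * ψ`, relative to the weighted norm. -/
lemma exists_integral_sq_add_lt {ν a κ δ : ℝ} (hν : 0 < ν) (hκ : 0 < κ)
    (hκν : 2 * (κ * ν) < 1 - 2 * a) (hδ : 0 < δ) :
    ∃ ψ : ℝ → ℝ, ContDiff ℝ (⊤ : ℕ∞) ψ ∧ HasCompactSupport ψ ∧ tsupport ψ ⊆ Set.Ioi 0 ∧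
      ∫ x in Set.Ioi (0 : ℝ), (deriv ψ x + κ * (ν + x) / x * ψ x) ^ 2 / (ν + x) * x ^ (2 - 2 * a)
        < δ * ∫ x in Set.Ioi (0 : ℝ), ψ x ^ 2 * x ^ (-2 * a) := by
  let b : ContDiffBump (0 : ℝ) := ⟨1, 2, one_pos, one_lt_two⟩
  have hη : ContDiff ℝ (⊤ : ℕ∞) b := b.contDiff
  have hη0 : ∀ y, 2 ≤ |y| → b y = 0 := fun y hy =>
    b.zero_of_le_dist (by simpa [Real.dist_eq, b] using hy)
  have hη1 : ∀ y, |y| ≤ 1 → b y = 1 := fun y hy =>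
    b.one_of_mem_closedBall (by simpa [Real.dist_eq, b] using hy)
  obtain ⟨M, hM⟩ := Continuous.bounded_above_of_compact_support
    (hη.continuous_deriv (by simp)) b.hasCompactSupport.deriv
  let φ : ℝ → ℝ := fun x => x ^ (-(κ * ν)) * Real.exp (-κ * x)
  let h : ℝ → ℝ := fun x => φ x ^ 2 * x ^ (-2 * a)
  have hint : IntegrableOn h (Set.Ioi 0) := by
    refine (integrableOn_rpow_mul_exp_neg_mul_rpow (p := 1) (s := -2 * (κ * ν) - 2 * a)
      (b := 2 * κ) (by linarith) one_pos (by linarith)).congr_fun (fun x hx => ?_)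
      measurableSet_Ioi
    have hx : 0 < x := hx
    simp only [h, φ, mul_pow, Real.rpow_one]
    rw [← Real.rpow_natCast (x ^ _), ← Real.rpow_mul hx.le, ← Real.exp_nat_mul, mul_right_comm,
      ← Real.rpow_add hx]
    push_cast
    ring_nf
  have hpos : ∀ x, 0 < x → 0 < h x := fun x hx => by simp only [h, φ]; positivity
  have hsub : Set.Ioc (1 : ℝ) 2 ⊆ Set.Ioi 0 := fun x hx => one_pos.trans hx.1
  have hA : 0 < ∫ x in Set.Ioc (1 : ℝ) 2, h x := by
    rw [setIntegral_pos_iff_support_of_nonneg_ae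
      ((ae_restrict_iff' measurableSet_Ioc).2 (.of_forall fun x hx => (hpos x (hsub hx)).le))
      (hint.mono_set hsub), Set.inter_eq_right.2 (show Set.Ioc 1 2 ⊆ Function.support h from
        fun x hx => (hpos x (hsub hx)).ne')]
    simp
  obtain ⟨t₀, ht₀, hlt⟩ := exists_pos_mul_lt (mul_pos hδ hA)
    (M ^ 2 / ν * ∫ x in Set.Ioi (0 : ℝ), h x)
  have hC : 0 ≤ M ^ 2 / ν * ∫ x in Set.Ioi (0 : ℝ), h x :=
    mul_nonneg (by positivity) (setIntegral_nonneg measurableSet_Ioi fun x hx => (hpos x hx).le)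
  let t := min t₀ 1
  have ht : 0 < t := lt_min ht₀ one_pos
  have ht1 : t ≤ 1 := min_le_right _ _
  let ψ := logCutoff b t (κ * ν) κ
  have hψ : ContDiff ℝ (⊤ : ℕ∞) ψ := contDiff_logCutoff hη hη0 ht
  have hsupp : tsupport ψ ⊆ _ := tsupport_logCutoff_subset hη0 ht
  have hcpt : HasCompactSupport ψ := isCompact_Icc.of_isClosed_subset (isClosed_tsupport _) hsupp
  have hs : tsupport ψ ⊆ Set.Ioi 0 := fun x hx => (Real.exp_pos _).trans_le (hsupp hx).1
  have hval : ∀ x, 0 < x → ψ x = b (t * Real.log x) * φ x := fun x hx =>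
    (logCutoff_eventuallyEq hx).self_of_nhds
  refine ⟨ψ, hψ, hcpt, hs, ?_⟩
  have hupper : ∫ x in Set.Ioi (0 : ℝ),
      (deriv ψ x + κ * (ν + x) / x * ψ x) ^ 2 / (ν + x) * x ^ (2 - 2 * a)
        ≤ ∫ x in Set.Ioi (0 : ℝ), t ^ 2 * (M ^ 2 / ν) * h x := by
    refine integral_mono_of_nonneg ((ae_restrict_iff' measurableSet_Ioi).2 (.of_forall ?_))
      (hint.const_mul _) ((ae_restrict_iff' measurableSet_Ioi).2 (.of_forall ?_))
    · intro x hx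
      have hx : 0 < x := hx
      simp only [Pi.zero_apply]
      positivity
    · intro x hx
      have hx : 0 < x := hx
      have e₁ : x ^ (2 - 2 * a) = x ^ (-2 * a) * x ^ 2 := by
        rw [← Real.rpow_natCast, ← Real.rpow_add hx]; congr 1; push_cast; ring
      have hM' : deriv b (t * Real.log x) ^ 2 ≤ M ^ 2 := by
        rw [← sq_abs]
        exact pow_le_pow_left₀ (abs_nonneg _) (hM _) 2
      simp only [ψ]
      rw [deriv_logCutoff_add hη hx, e₁]
      calc _ = t ^ 2 * (deriv b (t * Real.log x) ^ 2 / (ν + x)) * h x := by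
            simp only [h, φ]; field_simp
        _ ≤ _ := by
            have := (hpos x hx).le
            gcongr
            linarith
  have hlower : ∫ x in Set.Ioc (1 : ℝ) 2, h x ≤
      ∫ x in Set.Ioi (0 : ℝ), ψ x ^ 2 * x ^ (-2 * a) := by
    have hi : IntegrableOn (fun x => ψ x ^ 2 * x ^ (-2 * a)) (Set.Ioi 0) := by
      refine (integrableOn_Ioi_mul_of_hasCompactSupport (u := fun x => ψ x * x ^ (-2 * a))
        (hψ.continuous.continuousOn.mul (continuousOn_id.rpow_const fun x hx =>
          Or.inl (ne_of_gt hx))) hψ.continuous hcpt hs).congr_fun (fun x _ => ?_)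
        measurableSet_Ioi
      ring
    refine le_trans (le_of_eq ?_) (setIntegral_mono_set hi
      ((ae_restrict_iff' measurableSet_Ioi).2 (.of_forall fun x hx => ?_)) hsub.eventuallyLE)
    · refine setIntegral_congr_fun measurableSet_Ioc fun x hx => ?_
      have hx0 : 0 < x := hsub hx
      have hl0 : 0 ≤ Real.log x := Real.log_nonneg hx.1.le
      have hl1 : Real.log x ≤ 1 := (Real.log_le_sub_one_of_pos hx0).trans (by linarith [hx.2])
      have : b (t * Real.log x) = 1 :=
        hη1 _ (by rw [abs_of_nonneg (by positivity)]; exact mul_le_one₀ ht1 hl0 hl1)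
      simp only [h, hval x hx0, this, one_mul]
    · have hx : 0 < x := hx
      simp only [Pi.zero_apply]
      positivity
  have htt : t ^ 2 ≤ t₀ := by
    have : t ≤ t₀ := min_le_left _ _
    nlinarith
  rw [integral_const_mul] at hupper
  calc _ ≤ _ := hupper
    _ = (M ^ 2 / ν * ∫ x in Set.Ioi (0 : ℝ), h x) * t ^ 2 := by ring
    _ ≤ (M ^ 2 / ν * ∫ x in Set.Ioi (0 : ℝ), h x) * t₀ := by gcongr
    _ < _ := hlt
    _ ≤ _ := by gcongr

theorem stmt6 (ν a : ℝ) (hν : ν ∈ Set.Ioc (0 : ℝ) (1/2)) (ha : a ∈ Set.Icc (0 : ℝ) (1/2 - ν))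
    (μ : ℝ) (hμ : μ = ((1/2 - a) - Real.sqrt ((1/2 - a)^2 - ν^2)) / ν)
    (μ' : ℝ) (hμ' : μ' ∈ Set.Ico (0 : ℝ) μ) :
    ∃ φ : ℝ → ℂ, ContDiff ℝ (⊤ : ℕ∞) φ ∧ HasCompactSupport φ ∧ tsupport φ ⊆ Set.Ioi (0 : ℝ) ∧
      (∫ ρ in Set.Ioi (0 : ℝ), ‖deriv φ ρ‖^2 / (ν + ρ) * ρ ^ (2 - 2*a))
        + μ'^2 * (∫ ρ in Set.Ioi (0 : ℝ), ‖φ ρ‖^2 * ρ ^ (1 - 2*a))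
        < ν * ∫ ρ in Set.Ioi (0 : ℝ), ‖φ ρ‖^2 * ρ ^ (-2*a) := by
  obtain ⟨hν0, -⟩ := hν
  obtain ⟨-, ha⟩ := ha
  obtain ⟨hμ0, hμlt⟩ := hμ'
  obtain ⟨κ, hκ', hκμ⟩ := exists_between hμlt
  have hκ : 0 < κ := hμ0.trans_lt hκ'
  have hr0 := Real.sqrt_nonneg ((1/2 - a)^2 - ν^2)
  have hr : Real.sqrt ((1/2 - a)^2 - ν^2) ^ 2 = (1/2 - a)^2 - ν^2 :=
    Real.sq_sqrt (by nlinarith)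
  set r := Real.sqrt ((1/2 - a)^2 - ν^2)
  have hκν : κ * ν < 1/2 - a - r := by rwa [hμ, lt_div_iff₀ hν0] at hκμ
  have hδ : 0 < ν - (κ * (1 - 2 * a) - κ ^ 2 * ν) := by
    refine pos_of_mul_pos_right (a := ν) ?_ hν0.le
    nlinarith
  obtain ⟨ψ, hψ, hc, hs, hlt⟩ :=
    exists_integral_sq_add_lt (a := a) hν0 hκ (by linarith) hδ
  rw [integral_sq_add_eq hν0 (hψ.of_le (by exact_mod_cast le_top)) hc hs] at hlt
  have hd : ∀ x, deriv (fun y => (ψ y : ℂ)) x = ((deriv ψ x : ℝ) : ℂ) := fun x =>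
    ((hψ.differentiable (by simp)) x).hasDerivAt.ofReal_comp.deriv
  have hB : 0 ≤ ∫ x in Set.Ioi (0 : ℝ), ψ x ^ 2 * x ^ (1 - 2 * a) :=
    setIntegral_nonneg measurableSet_Ioi fun x hx => by
      have hx : 0 < x := hx
      positivity
  refine ⟨fun x => (ψ x : ℂ), Complex.ofRealCLM.contDiff.comp hψ, hc.comp_left Complex.ofReal_zero,
    (tsupport_comp_subset Complex.ofReal_zero ψ).trans hs, ?_⟩
  simp only [hd, Complex.norm_real, Real.norm_eq_abs, sq_abs]
  nlinarith [mul_le_mul_of_nonneg_right (pow_le_pow_left₀ hμ0 hκ'.le 2) hB]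
end

section
/- Let a ∈ [0,1/2], ν > 0, λ > −1, and ℓ ∈ ℤ with ℓ ≠ 0. Then for every φ ∈ C_c^∞((0,∞),ℂ), ∫₀^∞ |ρ φ'(ρ) − ℓ φ(ρ)|² / ((1+λ)ρ + ν) · ρ^{−2a} dρ ≥ ∫₀^∞ ρ² |φ'(ρ)|² / ((1+λ)ρ + ν) · ρ^{−2a} dρ. -/
open MeasureTheory

open Set Filter Topology

/-- A function continuous on `(0, ∞)` and vanishing outside a compact subset of `(0, ∞)` is
integrable there. -/
lemma integrableOn_Ioi_of_continuousOn_of_eq_zero {E : Type*} [NormedAddCommGroup E]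
    {g : ℝ → E} {K : Set ℝ} (hK : IsCompact K) (hK0 : K ⊆ Ioi (0 : ℝ))
    (hg : ContinuousOn g (Ioi 0)) (hz : ∀ x, x ∉ K → g x = 0) :
    IntegrableOn g (Ioi 0) := by
  have h : IntegrableOn g K := (hg.mono hK0).integrableOn_compact hK
  exact h.of_forall_sdiff_eq_zero measurableSet_Ioi fun x hx => hz x hx.2

/-- Weighted integration by parts against `‖φ‖²` for `φ` compactly supported in `(0, ∞)`. -/
lemma integral_Ioi_deriv_mul_norm_sq_eq_zero {E : Type*} [NormedAddCommGroup E]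
    [InnerProductSpace ℝ E] {W W' : ℝ → ℝ} {φ : ℝ → E}
    (hW : ∀ x ∈ Ioi (0 : ℝ), HasDerivAt W (W' x) x) (hW' : ContinuousOn W' (Ioi 0))
    (hφs : ContDiff ℝ 1 φ) (hφc : HasCompactSupport φ) (hφ0 : tsupport φ ⊆ Ioi (0 : ℝ)) :
    IntegrableOn (fun x => W' x * ‖φ x‖ ^ 2 + W x * (2 * inner ℝ (φ x) (deriv φ x))) (Ioi 0) ∧
    ∫ x in Ioi (0 : ℝ), (W' x * ‖φ x‖ ^ 2 + W x * (2 * inner ℝ (φ x) (deriv φ x))) = 0 := by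
  have hWc : ContinuousOn W (Ioi 0) := fun x hx => (hW x hx).continuousAt.continuousWithinAt
  have hφcont : Continuous φ := hφs.continuous
  have hdcont : Continuous (deriv φ) := hφs.continuous_deriv le_rfl
  have hGi : IntegrableOn
      (fun x => W' x * ‖φ x‖ ^ 2 + W x * (2 * inner ℝ (φ x) (deriv φ x))) (Ioi 0) := by
    refine integrableOn_Ioi_of_continuousOn_of_eq_zero hφc hφ0 ?_ fun x hx => ?_
    · exact (hW'.mul (by fun_prop)).add (hWc.mul (by fun_prop))
    · simp [image_eq_zero_of_notMem_tsupport hx]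
  refine ⟨hGi, ?_⟩
  have h0 : (fun x => W x * ‖φ x‖ ^ 2) =ᶠ[𝓝 0] fun _ => 0 := by
    have h : (0 : ℝ) ∉ tsupport φ := fun h => self_notMem_Ioi (hφ0 h)
    filter_upwards [notMem_tsupport_iff_eventuallyEq.mp h] with x hx
    simp [hx]
  have htop : (fun x => W x * ‖φ x‖ ^ 2) =ᶠ[atTop] fun _ => 0 := by
    have h : ∀ᶠ x in atTop, x ∉ tsupport φ :=
      atTop_le_cocompact hφc.isCompact.compl_mem_cocompact
    filter_upwards [h] with x hx
    simp [image_eq_zero_of_notMem_tsupport hx]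
  have := integral_Ioi_of_hasDerivAt_of_tendsto (a := (0 : ℝ)) (m := 0)
    (f := fun x => W x * ‖φ x‖ ^ 2)
    ((continuousAt_const.congr h0.symm).continuousWithinAt)
    (fun x hx => (hW x hx).mul
      ((hφs.differentiable one_ne_zero x).hasDerivAt.norm_sq)) hGi
    (tendsto_const_nhds.congr' htop.symm)
  exact this.trans (by rw [zero_sub, neg_eq_zero]; exact h0.self_of_nhds)

lemma hasDerivAt_mul_rpow_div_linear {a c ν x : ℝ} (hx : 0 < x) (hD : c * x + ν ≠ 0) :
    HasDerivAt (fun y : ℝ => y * (y ^ (-2 * a) / (c * y + ν)))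
      (x ^ (-2 * a) / (c * x + ν) * (1 - 2 * a - c * x / (c * x + ν))) x := by
  have hp : HasDerivAt (fun y : ℝ => y ^ (-2 * a)) (-2 * a * x ^ (-2 * a - 1)) x :=
    Real.hasDerivAt_rpow_const (Or.inl hx.ne')
  have hl : HasDerivAt (fun y : ℝ => c * y + ν) (c * 1) x :=
    ((hasDerivAt_id x).const_mul c).add_const ν
  refine ((hasDerivAt_id' x).mul (hp.div hl hD)).congr_deriv ?_
  rw [Pi.div_apply, Real.rpow_sub_one hx.ne']
  field_simp
  ring

lemma int_sq_add_mul_nonneg {n : ℤ} (hn : n ≠ 0) {θ : ℝ} (hθ : |θ| ≤ 1) :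
    0 ≤ (n : ℝ) ^ 2 + n * θ := by
  have h1 : (1 : ℝ) ≤ |(n : ℝ)| := by exact_mod_cast Int.one_le_abs hn
  have h2 : |(n : ℝ) * θ| ≤ |(n : ℝ)| * 1 := by
    rw [abs_mul]; gcongr
  nlinarith [neg_abs_le ((n : ℝ) * θ), sq_abs (n : ℝ)]

lemma Complex.norm_ofReal_mul_sub_ofReal_mul_sq (r s : ℝ) (z w : ℂ) :
    ‖r * z - s * w‖ ^ 2 = r ^ 2 * ‖z‖ ^ 2 + s ^ 2 * ‖w‖ ^ 2 - s * r * (2 * inner ℝ w z) := by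
  simp only [Complex.sq_norm, Complex.normSq_apply, Complex.inner, Complex.sub_re, Complex.sub_im,
    Complex.mul_re, Complex.mul_im, Complex.ofReal_re, Complex.ofReal_im, Complex.conj_re,
    Complex.conj_im]
  ring

theorem stmt7 (a ν lam : ℝ) (ha : a ∈ Set.Icc (0 : ℝ) (1/2)) (hν : 0 < ν) (hlam : -1 < lam)
    (ℓ : ℤ) (hℓ : ℓ ≠ 0)
    (φ : ℝ → ℂ) (hφs : ContDiff ℝ (⊤ : ℕ∞) φ) (hφc : HasCompactSupport φ)
    (hφ0 : tsupport φ ⊆ Set.Ioi (0 : ℝ)) :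
    ∫ ρ in Set.Ioi (0 : ℝ), ‖ρ * deriv φ ρ - (ℓ : ℂ) * φ ρ‖^2 / ((1 + lam) * ρ + ν) * ρ ^ (-2*a)
      ≥ ∫ ρ in Set.Ioi (0 : ℝ), ρ^2 * ‖deriv φ ρ‖^2 / ((1 + lam) * ρ + ν) * ρ ^ (-2*a) := by
  have hc : 0 < 1 + lam := by linarith
  set c := 1 + lam
  have hD : ∀ x ∈ Ioi (0 : ℝ), 0 < c * x + ν := fun x hx => by
    have : 0 < c * x := mul_pos hc hx
    linarith
  have hφ1 : ContDiff ℝ 1 φ := hφs.of_le (by exact_mod_cast le_top)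
  have hφcont : Continuous φ := hφ1.continuous
  have hdcont : Continuous (deriv φ) := hφ1.continuous_deriv le_rfl
  have hpow : ContinuousOn (fun x : ℝ => x ^ (-2 * a)) (Ioi 0) := fun x hx =>
    (Real.continuousAt_rpow_const x _ (Or.inl (ne_of_gt hx))).continuousWithinAt
  have hlin : ContinuousOn (fun x : ℝ => c * x + ν) (Ioi 0) := by fun_prop
  have hD' : ∀ x ∈ Ioi (0 : ℝ), c * x + ν ≠ 0 := fun x hx => (hD x hx).ne'
  have hφz : ∀ x, x ∉ tsupport φ → φ x = 0 := fun x hx => image_eq_zero_of_notMem_tsupport hx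
  have hdz : ∀ x, x ∉ tsupport φ → deriv φ x = 0 := fun x hx => by
    by_contra h
    exact hx (support_deriv_subset h)
  obtain ⟨hGint, hG⟩ := integral_Ioi_deriv_mul_norm_sq_eq_zero
    (fun x hx => hasDerivAt_mul_rpow_div_linear (a := a) hx (hD' x hx))
    ((hpow.div hlin hD').mul (continuousOn_const.sub
      (ContinuousOn.div (by fun_prop) hlin hD'))) hφ1 hφc hφ0
  have hRint : IntegrableOn
      (fun ρ : ℝ => ρ^2 * ‖deriv φ ρ‖^2 / (c * ρ + ν) * ρ ^ (-2*a)) (Ioi 0) := by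
    refine integrableOn_Ioi_of_continuousOn_of_eq_zero hφc hφ0 ?_ fun x hx => ?_
    · exact (ContinuousOn.div (by fun_prop) hlin hD').mul hpow
    · simp [hdz x hx]
  have hLint : IntegrableOn
      (fun ρ : ℝ => ‖ρ * deriv φ ρ - (ℓ : ℂ) * φ ρ‖^2 / (c * ρ + ν) * ρ ^ (-2*a)) (Ioi 0) := by
    refine integrableOn_Ioi_of_continuousOn_of_eq_zero hφc hφ0 ?_ fun x hx => ?_
    · exact (ContinuousOn.div (by fun_prop) hlin hD').mul hpow
    · simp [hdz x hx, hφz x hx]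
  have key := setIntegral_mono_on (hRint.sub (hGint.const_mul (ℓ : ℝ))) hLint measurableSet_Ioi
    fun x hx => ?_
  · have hs := integral_sub hRint (hGint.const_mul (ℓ : ℝ))
    rw [integral_const_mul, hG, mul_zero, sub_zero] at hs
    exact hs.symm.le.trans key
  · have hDx := hD x hx
    have hθ : |1 - 2 * a - c * x / (c * x + ν)| ≤ 1 := by
      have h1 : 0 ≤ c * x / (c * x + ν) := div_nonneg (mul_pos hc hx).le hDx.le
      have h2 : c * x / (c * x + ν) ≤ 1 := (div_le_one hDx).2 (by linarith)
      rw [abs_le]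
      constructor <;> linarith [ha.1, ha.2]
    have hw : 0 ≤ x ^ (-2 * a) / (c * x + ν) :=
      div_nonneg (Real.rpow_nonneg (le_of_lt hx) _) hDx.le
    have hnn := mul_nonneg (mul_nonneg hw (sq_nonneg ‖φ x‖)) (int_sq_add_mul_nonneg hℓ hθ)
    have hexp := Complex.norm_ofReal_mul_sub_ofReal_mul_sq x ℓ (deriv φ x) (φ x)
    rw [Complex.ofReal_intCast] at hexp
    simp only [Pi.sub_apply]
    rw [hexp, ← sub_nonneg]
    convert hnn using 1
    ring
end

section
/- Let a ∈ ℝ, ν > 0 and μ ∈ ℝ. Then for every φ ∈ C_c^∞((0,∞),ℂ), ∫₀^∞ |ρ φ'(ρ) + μ(ν+ρ) φ(ρ)|² / (ν+ρ) · ρ^{−2a} dρ = ∫₀^∞ |φ'(ρ)|²/(ν+ρ) · ρ^{2−2a} dρ + μ² ∫₀^∞ |φ(ρ)|² ρ^{1−2a} dρ + (ν μ² − (1−2a) μ) ∫₀^∞ |φ(ρ)|² ρ^{−2a} dρ. -/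
open MeasureTheory

/-- A continuous function compactly supported in `(0, ∞)`, multiplied by a function continuous on
`(0, ∞)`, is integrable on `(0, ∞)`. -/
lemma integrableOn_Ioi_mul_of_tsupport_subset {g h : ℝ → ℝ} (hg : Continuous g)
    (hc : HasCompactSupport g) (hs : tsupport g ⊆ Set.Ioi (0 : ℝ))
    (hh : ContinuousOn h (Set.Ioi 0)) :
    IntegrableOn (fun x => g x * h x) (Set.Ioi 0) := by
  have hcont : Continuous (fun x => g x * h x) :=
    (hg.continuousOn.mul hh).continuous_of_tsupport_subset isOpen_Ioi
      ((tsupport_mul_subset_left (f := g) (g := h)).trans hs)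
  exact (hcont.integrable_of_hasCompactSupport hc.mul_right).integrableOn

lemma hasDerivAt_norm_sq_mul_rpow {φ : ℝ → ℂ} (hφ : Differentiable ℝ φ) (b : ℝ) {x : ℝ}
    (hx : 0 < x) :
    HasDerivAt (fun x => ‖φ x‖ ^ 2 * x ^ b)
      (2 * inner ℝ (φ x) (deriv φ x) * x ^ b + ‖φ x‖ ^ 2 * (b * x ^ (b - 1))) x :=
  (hφ x).hasDerivAt.norm_sq.mul (Real.hasDerivAt_rpow_const (Or.inl hx.ne'))

lemma integral_Ioi_deriv_norm_sq_mul_rpow {φ : ℝ → ℂ} (hφs : ContDiff ℝ 1 φ)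
    (hφc : HasCompactSupport φ) (hφ0 : tsupport φ ⊆ Set.Ioi (0 : ℝ)) (b : ℝ) :
    ∫ x in Set.Ioi (0 : ℝ),
      (2 * inner ℝ (φ x) (deriv φ x) * x ^ b + ‖φ x‖ ^ 2 * (b * x ^ (b - 1))) = 0 := by
  have hsub : Function.support (fun x => ‖φ x‖ ^ 2 * x ^ b) ⊆ Function.support φ := by
    intro x hx h
    simp [h] at hx
  have hF : ContDiff ℝ 1 (fun x => ‖φ x‖ ^ 2 * x ^ b) := by
    refine contDiff_iff_contDiffAt.2 fun x => ?_
    by_cases hx : x ∈ tsupport (fun x => ‖φ x‖ ^ 2 * x ^ b)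
    swap
    · exact contDiffAt_const.congr_of_eventuallyEq (notMem_tsupport_iff_eventuallyEq.1 hx)
    have hx0 : 0 < x := hφ0 (closure_mono hsub hx)
    exact (hφs.contDiffAt.norm_sq ℝ).mul (Real.contDiffAt_rpow_const_of_ne hx0.ne')
  have hFc : HasCompactSupport (fun x => ‖φ x‖ ^ 2 * x ^ b) := hφc.mono hsub
  have h0 : φ 0 = 0 := image_eq_zero_of_notMem_tsupport fun h => lt_irrefl (0 : ℝ) (hφ0 h)
  have key := hFc.integral_Ioi_deriv_eq hF 0
  rw [← setIntegral_congr_fun measurableSet_Ioi fun x hx =>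
    (hasDerivAt_norm_sq_mul_rpow (hφs.differentiable one_ne_zero) b hx).deriv, key]
  simp [h0]

theorem stmt8 (a ν μ : ℝ) (hν : 0 < ν)
    (φ : ℝ → ℂ) (hφs : ContDiff ℝ (⊤ : ℕ∞) φ) (hφc : HasCompactSupport φ)
    (hφ0 : tsupport φ ⊆ Set.Ioi (0 : ℝ)) :
    ∫ ρ in Set.Ioi (0 : ℝ),
        ‖(ρ : ℂ) * deriv φ ρ + (μ : ℂ) * ((ν : ℂ) + ρ) * φ ρ‖^2 / (ν + ρ) * ρ ^ (-2*a)
      = (∫ ρ in Set.Ioi (0 : ℝ), ‖deriv φ ρ‖^2 / (ν + ρ) * ρ ^ (2 - 2*a))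
        + μ^2 * (∫ ρ in Set.Ioi (0 : ℝ), ‖φ ρ‖^2 * ρ ^ (1 - 2*a))
        + (ν * μ^2 - (1 - 2*a) * μ) * ∫ ρ in Set.Ioi (0 : ℝ), ‖φ ρ‖^2 * ρ ^ (-2*a) := by
  have hφ1 : ContDiff ℝ 1 φ := hφs.of_le (by exact_mod_cast le_top)
  have hd : Continuous (deriv φ) := hφ1.continuous_deriv le_rfl
  have hrpow (b : ℝ) : ContinuousOn (fun x : ℝ => x ^ b) (Set.Ioi 0) := fun x hx =>
    (Real.continuousAt_rpow_const x b (Or.inl (ne_of_gt hx))).continuousWithinAt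
  have hsq {f : ℝ → ℂ} (hf : Function.support f ⊆ tsupport φ) :
      Function.support (fun x => ‖f x‖ ^ 2) ⊆ tsupport φ := by
    intro x hx
    refine hf fun h => ?_
    simp [h] at hx
  have hint {g h : ℝ → ℝ} (hg : Continuous g) (hs : Function.support g ⊆ tsupport φ)
      (hh : ContinuousOn h (Set.Ioi 0)) : IntegrableOn (fun x => g x * h x) (Set.Ioi 0) :=
    integrableOn_Ioi_mul_of_tsupport_subset hg (hφc.mono' hs)
      ((closure_minimal hs (isClosed_tsupport φ)).trans hφ0) hh
  have hI1 : IntegrableOn (fun ρ : ℝ => ‖deriv φ ρ‖^2 / (ν + ρ) * ρ ^ (2 - 2*a))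
      (Set.Ioi 0) := by
    have : ContinuousOn (fun ρ : ℝ => (ν + ρ)⁻¹ * ρ ^ (2 - 2*a)) (Set.Ioi 0) :=
      ((continuousOn_const.add continuousOn_id).inv₀
        fun x hx => (add_pos hν hx).ne').mul (hrpow _)
    simpa only [div_eq_mul_inv, mul_assoc, Pi.pow_apply] using
      hint (hd.norm.pow 2) (hsq support_deriv_subset) this
  have hI2 (b : ℝ) : IntegrableOn (fun ρ : ℝ => ‖φ ρ‖^2 * ρ ^ b) (Set.Ioi 0) :=
    hint (hφ1.continuous.norm.pow 2) (hsq subset_closure) (hrpow b)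
  have hI3 : IntegrableOn (fun x : ℝ => 2 * inner ℝ (φ x) (deriv φ x) * x ^ (1 - 2*a)
      + ‖φ x‖ ^ 2 * ((1 - 2*a) * x ^ (1 - 2*a - 1))) (Set.Ioi 0) := by
    refine (hint (continuous_const.mul (hφ1.continuous.inner hd)) ?_ (hrpow _)).add
      (hint (hφ1.continuous.norm.pow 2) (hsq subset_closure)
        (continuousOn_const.mul (hrpow _)))
    intro x hx
    refine subset_closure fun h => ?_
    simp [h] at hx
  have hpt : ∀ ρ ∈ Set.Ioi (0 : ℝ),
      ‖(ρ : ℂ) * deriv φ ρ + (μ : ℂ) * ((ν : ℂ) + ρ) * φ ρ‖^2 / (ν + ρ) * ρ ^ (-2*a)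
      = ‖deriv φ ρ‖^2 / (ν + ρ) * ρ ^ (2 - 2*a) + μ^2 * (‖φ ρ‖^2 * ρ ^ (1 - 2*a))
        + (ν * μ^2 - (1 - 2*a) * μ) * (‖φ ρ‖^2 * ρ ^ (-2*a))
        + μ * (2 * inner ℝ (φ ρ) (deriv φ ρ) * ρ ^ (1 - 2*a)
          + ‖φ ρ‖ ^ 2 * ((1 - 2*a) * ρ ^ (1 - 2*a - 1))) := by
    intro ρ hρ
    have hρ0 : (0 : ℝ) < ρ := hρ
    have hne : ν + ρ ≠ 0 := (add_pos hν hρ0).ne'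
    have e0 : (1 - 2*a - 1 : ℝ) = -2*a := by ring
    have e1 : ρ ^ (1 - 2*a) = ρ * ρ ^ (-2*a) := by
      rw [show (1 - 2*a : ℝ) = 1 + -2*a by ring, Real.rpow_add hρ0, Real.rpow_one]
    have e2 : ρ ^ (2 - 2*a) = ρ^2 * ρ ^ (-2*a) := by
      rw [show (2 - 2*a : ℝ) = 2 + -2*a by ring, Real.rpow_add hρ0, Real.rpow_two]
    rw [e0, e1, e2]
    simp only [Complex.sq_norm, Complex.normSq_apply, Complex.inner, Complex.mul_re,
      Complex.mul_im, Complex.add_re, Complex.add_im, Complex.ofReal_re, Complex.ofReal_im,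
      Complex.conj_re, Complex.conj_im]
    field_simp
    ring
  have hJ1 := (hI2 (1 - 2*a)).const_mul (μ^2)
  have hJ2 := (hI2 (-2*a)).const_mul (ν * μ^2 - (1 - 2*a) * μ)
  rw [setIntegral_congr_fun measurableSet_Ioi hpt,
    integral_add (by exact (hI1.add hJ1).add hJ2) (hI3.const_mul μ),
    integral_add (by exact hI1.add hJ1) hJ2, integral_add hI1 hJ1]
  simp only [integral_const_mul, integral_Ioi_deriv_norm_sq_mul_rpow hφ1 hφc hφ0, mul_zero,
    add_zero]
end
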